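/- arXiv:math/0011234 — 5 statements merged into one kernel-verified Lean document; each statement's English description precedes it below -/
import Mathlib

section
/- The geometric realization of the discrete Morse complex M(Δ_2) of the 2-dimensional simplex Δ_2 is homotopy equivalent to a wedge of four circles S^1 ∨ S^1 ∨ S^1 ∨ S^1; and the discrete Morse complex M(Δ_1) of the 1-dimensional simplex consists of exactly two points, i.e., its realization is homotopy equivalent to S^0. -/
open Finset

/-- Arc of the Hasse diagram of the simplicial complex `K`: from `g` to `f` whenever
`f ⊂ g` and `dim g = dim f + 1`. -/
def HasseArc {V : Type} [DecidableEq V] (K : Finset (Finset V)) (g f : Finset V) : Prop :=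
  g ∈ K ∧ f ∈ K ∧ f ⊂ g ∧ g.card = f.card + 1

/-- `M` is a matching: no two distinct pairs of `M` share an endpoint. -/
def IsMatchingPairs {α : Type} (M : Set (α × α)) : Prop :=
  ∀ p ∈ M, ∀ q ∈ M, p ≠ q → p.1 ≠ q.1 ∧ p.1 ≠ q.2 ∧ p.2 ≠ q.1 ∧ p.2 ≠ q.2

/-- One step of the Hasse diagram of `K` with the arcs belonging to `M` reversed. -/
def MorseStep {V : Type} [DecidableEq V] (K : Finset (Finset V))
    (M : Set (Finset V × Finset V)) (x y : Finset V) : Prop :=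
  (HasseArc K x y ∧ (x, y) ∉ M) ∨ ((y, x) ∈ M ∧ HasseArc K y x)

/-- A (discrete) Morse matching on the complex `K`: a matching in the Hasse diagram of `K`
such that reversing exactly the arcs of the matching yields a directed graph with no
directed cycle. -/
def IsMorseMatching {V : Type} [DecidableEq V] (K : Finset (Finset V))
    (M : Set (Finset V × Finset V)) : Prop :=
  (∀ p ∈ M, HasseArc K p.1 p.2) ∧ IsMatchingPairs M ∧
    ∀ s : Finset V, ¬ Relation.TransGen (MorseStep K M) s s

/-- A finite graph regarded as a one-dimensional simplicial complex: faces are the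
vertices (as singletons) and the edges (as two-element sets). -/
noncomputable def graphComplex {V : Type} [Fintype V] [DecidableEq V] (G : SimpleGraph V) :
    Finset (Finset V) := by
  classical
  exact Finset.univ.filter fun s => (∃ v, s = {v}) ∨ ∃ u v, G.Adj u v ∧ s = {u, v}

/-- Geometric realization of the finite abstract simplicial complex `K`, as a subspace of
`V → ℝ`: the convex combinations of vertices whose support is a face of `K`. -/
def realization {V : Type} [Fintype V] (K : Finset (Finset V)) : Set (V → ℝ) :=
  {x | (∀ v, 0 ≤ x v) ∧ (∑ v, x v) = 1 ∧ ∃ s ∈ K, ∀ v, x v ≠ 0 ↔ v ∈ s}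

/-- The `k`-dimensional sphere, as a type. -/
noncomputable def NSphere (k : ℕ) : Type :=
  ↥(Metric.sphere (0 : EuclideanSpace ℝ (Fin (k + 1))) 1)

noncomputable instance (k : ℕ) : TopologicalSpace (NSphere k) :=
  inferInstanceAs (TopologicalSpace ↥(Metric.sphere (0 : EuclideanSpace ℝ (Fin (k + 1))) 1))

/-- The wedge (one-point union) of four pointed spaces: the disjoint union with the four
base points identified. -/
def Wedge4 (X Y Z W : Type) [TopologicalSpace X] [TopologicalSpace Y] [TopologicalSpace Z]
    [TopologicalSpace W] (x₀ : X) (y₀ : Y) (z₀ : Z) (w₀ : W) : Type :=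
  Quot fun u v : X ⊕ Y ⊕ Z ⊕ W =>
    (u = Sum.inl x₀ ∧ v = Sum.inr (Sum.inl y₀)) ∨
    (u = Sum.inl x₀ ∧ v = Sum.inr (Sum.inr (Sum.inl z₀))) ∨
    (u = Sum.inl x₀ ∧ v = Sum.inr (Sum.inr (Sum.inr w₀)))

instance (X Y Z W : Type) [TopologicalSpace X] [TopologicalSpace Y] [TopologicalSpace Z]
    [TopologicalSpace W] (x₀ : X) (y₀ : Y) (z₀ : Z) (w₀ : W) :
    TopologicalSpace (Wedge4 X Y Z W x₀ y₀ z₀ w₀) :=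
  inferInstanceAs (TopologicalSpace (Quot _))

/-- The discrete Morse complex of the complex `K`: its faces are the nonempty Morse
matchings on `K`. -/
noncomputable def morseComplex {V : Type} [Fintype V] [DecidableEq V]
    (K : Finset (Finset V)) : Finset (Finset (Finset V × Finset V)) := by
  classical
  exact Finset.univ.filter fun M => M.Nonempty ∧ IsMorseMatching K ↑M

/-- The `d`-dimensional simplex `Δ_d`: the complex of all nonempty subsets of a
`(d+1)`-element set. -/
def simplexComplex (d : ℕ) : Finset (Finset (Fin (d + 1))) :=
  (Finset.univ : Finset (Fin (d + 1))).powerset.filter fun s => s.Nonempty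

/-! ### Polyhedra given by lists of faces -/

section Polyhedron

variable {V : Type} [Fintype V]

/-- The polyhedron spanned by a list of (not necessarily maximal) faces: the convex combinations
of vertices whose support lies in one of the listed faces. -/
def polyhedron (L : List (List V)) : Set (V → ℝ) :=
  {x | (∀ v, 0 ≤ x v) ∧ ∑ v, x v = 1 ∧ ∃ t ∈ L, ∀ v, x v ≠ 0 → v ∈ t}

theorem polyhedron_mono {L L' : List (List V)} (h : ∀ t ∈ L, ∃ t' ∈ L', ∀ v ∈ t, v ∈ t') :
    polyhedron L ⊆ polyhedron L' := by
  rintro x ⟨hx, hs, t, ht, hxt⟩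
  obtain ⟨t', ht', htt'⟩ := h t ht
  exact ⟨hx, hs, t', ht', fun v hv => htt' v (hxt v hv)⟩

/-- Maps into a polyhedron that are pointwise carried by a common face are homotopic, by the
straight-line homotopy. -/
theorem homotopic_of_common_face {L : List (List V)} {Y : Type} [TopologicalSpace Y]
    (f g : C(Y, polyhedron L))
    (h : ∀ y, ∃ t ∈ L, ∀ v, ((f y).1 v ≠ 0 → v ∈ t) ∧ ((g y).1 v ≠ 0 → v ∈ t)) :
    f.Homotopic g := by
  have hmem : ∀ q : unitInterval × Y,
      (fun v => (1 - (q.1 : ℝ)) * (f q.2).1 v + (q.1 : ℝ) * (g q.2).1 v) ∈ polyhedron L := by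
    rintro ⟨s, y⟩
    obtain ⟨t, ht, hv⟩ := h y
    refine ⟨fun v => ?_, ?_, t, ht, fun v hne => ?_⟩
    · have h1 := (f y).2.1 v
      have h2 := (g y).2.1 v
      have h3 := s.2.1
      have h4 := sub_nonneg.2 s.2.2
      positivity
    · simp only [Finset.sum_add_distrib, ← Finset.mul_sum, (f y).2.2.1, (g y).2.2.1]
      ring
    · by_contra hvt
      have h1 : (f y).1 v = 0 := by_contra fun hf => hvt ((hv v).1 hf)
      have h2 : (g y).1 v = 0 := by_contra fun hg => hvt ((hv v).2 hg)
      simp [h1, h2] at hne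
  refine ⟨⟨⟨fun q => ⟨_, hmem q⟩, ?_⟩, fun y => ?_, fun y => ?_⟩⟩
  · refine Continuous.subtype_mk (continuous_pi fun v => ?_) _
    have h1 : Continuous fun q : unitInterval × Y => (f q.2).1 v :=
      (continuous_apply v).comp (continuous_subtype_val.comp (f.continuous.comp continuous_snd))
    have h2 : Continuous fun q : unitInterval × Y => (g q.2).1 v :=
      (continuous_apply v).comp (continuous_subtype_val.comp (g.continuous.comp continuous_snd))
    have h3 : Continuous fun q : unitInterval × Y => (q.1 : ℝ) :=
      continuous_subtype_val.comp continuous_fst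
    exact ((continuous_const.sub h3).mul h1).add (h3.mul h2)
  · ext v; simp
  · ext v; simp

end Polyhedron

section Push

variable {V : Type} [DecidableEq V]

/-- The map pushing the face `{u, v}` towards the vertex `w`. -/
def pushToward (u v w : V) (x : V → ℝ) (z : V) : ℝ :=
  x z - min (x u) (x v) * (if z ∈ ({u, v} : Finset V) then 1 else 0) +
    (#{u, v} : ℝ) * min (x u) (x v) * (if z = w then 1 else 0)

theorem sum_pushToward [Fintype V] (u v w : V) (x : V → ℝ) :
    ∑ z, pushToward u v w x z = ∑ z, x z := by
  simp only [pushToward, Finset.sum_add_distrib, Finset.sum_sub_distrib, ← Finset.mul_sum]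
  simp only [Finset.sum_boole, Finset.filter_mem_eq_inter, Finset.filter_eq']
  simp
  ring

theorem pushToward_eq_self {u v : V} (w : V) {x : V → ℝ} (h : min (x u) (x v) = 0) :
    pushToward u v w x = x := by
  ext z; simp [pushToward, h]

theorem continuous_pushToward (u v w : V) : Continuous (pushToward u v w) := by
  unfold pushToward
  fun_prop

theorem pushToward_nonneg {u v : V} (w : V) {x : V → ℝ} (hx : ∀ z, 0 ≤ x z) (z : V) :
    0 ≤ pushToward u v w x z := by
  have hm : 0 ≤ min (x u) (x v) := le_min (hx u) (hx v)
  have h1 : 0 ≤ (#{u, v} : ℝ) * min (x u) (x v) * (if z = w then 1 else 0) := by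
    split_ifs <;> positivity
  have h2 : min (x u) (x v) * (if z ∈ ({u, v} : Finset V) then 1 else 0) ≤ x z := by
    split_ifs with hz
    · rcases Finset.mem_insert.1 hz with rfl | hz
      · simp
      · rw [Finset.mem_singleton.1 hz]; simp
    · simpa using hx z
  unfold pushToward
  linarith

end Push

section Collapse

variable {V : Type} [Fintype V] [DecidableEq V]

/-- The face list obtained by deleting all faces containing both `u` and `v`. -/
def deleteFace (L : List (List V)) (u v : V) : List (List V) :=
  L.flatMap fun t =>
    if u ∈ t ∧ v ∈ t then [t.filter (· ≠ u), t.filter (· ≠ v)] else [t]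

/-- The face `{u, v}` may be collapsed towards `w`: every listed face containing it together with
`w` is contained in a listed face. -/
def Collapsible (L : List (List V)) (u v w : V) : Prop :=
  w ≠ u ∧ w ≠ v ∧ ∀ t ∈ L, u ∈ t → v ∈ t → ∃ t' ∈ L, w ∈ t' ∧ ∀ z ∈ t, z ∈ t'

instance (L : List (List V)) (u v w : V) : Decidable (Collapsible L u v w) := by
  unfold Collapsible; infer_instance

theorem polyhedron_deleteFace_subset (L : List (List V)) (u v : V) :
    polyhedron (deleteFace L u v) ⊆ polyhedron L := by
  refine polyhedron_mono fun t ht => ?_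
  obtain ⟨t', ht', h⟩ := List.mem_flatMap.1 ht
  refine ⟨t', ht', ?_⟩
  split_ifs at h
  · rcases List.mem_pair.1 h with rfl | rfl <;> intro z hz <;> exact (List.mem_filter.1 hz).1
  · rw [List.mem_singleton.1 h]; exact fun _ hz => hz

theorem min_eq_zero_of_mem_deleteFace {L : List (List V)} {u v : V} {x : V → ℝ}
    (hx : x ∈ polyhedron (deleteFace L u v)) : min (x u) (x v) = 0 := by
  obtain ⟨hx0, -, t, ht, hxt⟩ := hx
  obtain ⟨t', -, h⟩ := List.mem_flatMap.1 ht
  have key : x u = 0 ∨ x v = 0 := by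
    by_contra! hne
    have hu := hxt u hne.1
    have hv := hxt v hne.2
    split_ifs at h with hc
    · rcases List.mem_pair.1 h with rfl | rfl <;> simp at hu hv
    · rw [List.mem_singleton.1 h] at hu hv; exact hc ⟨hu, hv⟩
  rcases key with h | h
  · rw [h]; exact min_eq_left (hx0 v)
  · rw [h]; exact min_eq_right (hx0 u)

/-- A point and its image under `pushToward` lie in a common face, and the image avoids the
deleted faces. -/
theorem exists_face_pushToward {L : List (List V)} {u v w : V} (h : Collapsible L u v w)
    {x : V → ℝ} (hx : x ∈ polyhedron L) :
    pushToward u v w x ∈ polyhedron (deleteFace L u v) ∧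
      ∃ t ∈ L, ∀ z, (pushToward u v w x z ≠ 0 → z ∈ t) ∧ (x z ≠ 0 → z ∈ t) := by
  obtain ⟨hwu, hwv, hL⟩ := h
  obtain ⟨hx0, hs, t, ht, hxt⟩ := hx
  have hsum := (sum_pushToward u v w x).trans hs
  by_cases hc : u ∈ t ∧ v ∈ t
  · obtain ⟨t', ht', hwt', htt'⟩ := hL t ht hc.1 hc.2
    have hsupp : ∀ z, pushToward u v w x z ≠ 0 → z ∈ t' := by
      intro z hz
      by_contra hzt
      have hzw : z ≠ w := fun e => hzt (e ▸ hwt')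
      have hzF : z ∉ ({u, v} : Finset V) := by
        intro hF
        rcases Finset.mem_insert.1 hF with rfl | hF
        · exact hzt (htt' _ hc.1)
        · exact hzt (htt' _ (Finset.mem_singleton.1 hF ▸ hc.2))
      have hxz : x z = 0 := by_contra fun hne => hzt (htt' z (hxt z hne))
      simp [pushToward, hzw, hxz] at hz
      exact hzF (by simpa using hz.1)
    refine ⟨⟨pushToward_nonneg w hx0, hsum, ?_⟩, t', ht',
      fun z => ⟨hsupp z, fun hz => htt' z (hxt z hz)⟩⟩
    have hc' : u ∈ t' ∧ v ∈ t' := ⟨htt' u hc.1, htt' v hc.2⟩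
    rcases le_total (x u) (x v) with hle | hle
    · refine ⟨t'.filter (· ≠ u), List.mem_flatMap.2 ⟨t', ht', by simp [hc']⟩, fun z hz => ?_⟩
      refine List.mem_filter.2 ⟨hsupp z hz, ?_⟩
      have : z ≠ u := by
        rintro rfl
        simp [pushToward, hle, hwu.symm] at hz
      simpa using this
    · refine ⟨t'.filter (· ≠ v), List.mem_flatMap.2 ⟨t', ht', by simp [hc']⟩, fun z hz => ?_⟩
      refine List.mem_filter.2 ⟨hsupp z hz, ?_⟩
      have : z ≠ v := by
        rintro rfl
        simp [pushToward, hle, hwv.symm] at hz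
      simpa using this
  · have hm : min (x u) (x v) = 0 := by
      rcases not_and_or.1 hc with hu | hv
      · rw [by_contra fun hne => hu (hxt u hne)]; exact min_eq_left (hx0 v)
      · rw [by_contra fun hne => hv (hxt v hne)]; exact min_eq_right (hx0 u)
    rw [pushToward_eq_self w hm]
    exact ⟨⟨hx0, hs, t, List.mem_flatMap.2 ⟨t, ht, by simp [hc]⟩, hxt⟩, t, ht,
      fun z => ⟨hxt z, hxt z⟩⟩

/-- Collapsing a face is a homotopy equivalence. -/
theorem homotopyEquiv_deleteFace {L : List (List V)} {u v w : V} (h : Collapsible L u v w) :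
    Nonempty (ContinuousMap.HomotopyEquiv (polyhedron L) (polyhedron (deleteFace L u v))) := by
  let r : C(polyhedron L, polyhedron (deleteFace L u v)) :=
    ⟨fun x => ⟨pushToward u v w x.1, (exists_face_pushToward h x.2).1⟩,
      ((continuous_pushToward u v w).comp continuous_subtype_val).subtype_mk _⟩
  let i : C(polyhedron (deleteFace L u v), polyhedron L) :=
    ⟨fun x => ⟨x.1, polyhedron_deleteFace_subset L u v x.2⟩,
      continuous_subtype_val.subtype_mk _⟩
  refine ⟨⟨r, i, ?_, ?_⟩⟩
  · exact homotopic_of_common_face _ _ fun x => (exists_face_pushToward h x.2).2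
  · have : r.comp i = ContinuousMap.id _ := by
      ext1 x
      exact Subtype.ext (pushToward_eq_self w (min_eq_zero_of_mem_deleteFace x.2))
    rw [this]

/-- The steps `(u, v, w)` can be performed one after the other as collapses of `{u, v}` towards
`w`, starting from `L` and ending in a face list spanning the same complex as `L'`. -/
def CollapsesTo (L' : List (List V)) : List (V × V × V) → List (List V) → Prop
  | [], L => (∀ t ∈ L, ∃ t' ∈ L', ∀ v ∈ t, v ∈ t') ∧ ∀ t ∈ L', ∃ t' ∈ L, ∀ v ∈ t, v ∈ t'
  | (u, v, w) :: l, L => Collapsible L u v w ∧ CollapsesTo L' l (deleteFace L u v)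

instance CollapsesTo.decidable (L' : List (List V)) :
    ∀ (l : List (V × V × V)) (L : List (List V)), Decidable (CollapsesTo L' l L)
  | [], L => by unfold CollapsesTo; infer_instance
  | (u, v, w) :: l, L => by
    have := CollapsesTo.decidable L' l (deleteFace L u v)
    unfold CollapsesTo; infer_instance

theorem CollapsesTo.homotopyEquiv {L' : List (List V)} {l : List (V × V × V)} :
    ∀ {L : List (List V)}, CollapsesTo L' l L →
      Nonempty (ContinuousMap.HomotopyEquiv (polyhedron L) (polyhedron L')) := by
  induction l with
  | nil =>
    intro L h
    have : polyhedron L = polyhedron L' := (polyhedron_mono h.1).antisymm (polyhedron_mono h.2)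
    exact ⟨(Homeomorph.setCongr this).toHomotopyEquiv⟩
  | cons a l ih =>
    intro L h
    obtain ⟨e⟩ := homotopyEquiv_deleteFace h.1
    obtain ⟨e'⟩ := ih h.2
    exact ⟨e.trans e'⟩

end Collapse

/-- Relabelling the vertices along an injection does not change a polyhedron. -/
theorem homotopyEquiv_polyhedron_map {V W : Type} [Fintype V] [Fintype W] {φ : V → W}
    (hφ : Function.Injective φ) (L : List (List V)) :
    Nonempty (ContinuousMap.HomotopyEquiv (polyhedron L)
      (polyhedron (L.map fun t => t.map φ))) := by
  have ext_self : ∀ (x : V → ℝ) v, Function.extend φ x (fun _ => 0) (φ v) = x v :=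
    fun x v => hφ.extend_apply x _ v
  have ext_zero : ∀ (x : V → ℝ) w, (¬ ∃ v, φ v = w) → Function.extend φ x (fun _ => 0) w = 0 :=
    fun x w hw => Function.extend_apply' x _ w hw
  have hto : ∀ x ∈ polyhedron L,
      Function.extend φ x (fun _ => 0) ∈ polyhedron (L.map fun t => t.map φ) := by
    rintro x ⟨hx, hs, t, ht, hxt⟩
    refine ⟨fun w => ?_, ?_, t.map φ, List.mem_map.2 ⟨t, ht, rfl⟩, fun w hw => ?_⟩
    · by_cases h : ∃ v, φ v = w
      · obtain ⟨v, rfl⟩ := h; rw [ext_self]; exact hx v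
      · rw [ext_zero x w h]
    · rw [← hs]
      exact (Fintype.sum_of_injective φ hφ _ _ (fun w hw => ext_zero x w hw)
        fun v => (ext_self x v).symm).symm
    · by_cases h : ∃ v, φ v = w
      · obtain ⟨v, rfl⟩ := h
        rw [ext_self] at hw
        exact List.mem_map.2 ⟨v, hxt v hw, rfl⟩
      · exact absurd (ext_zero x w h) hw
  have hzero : ∀ x ∈ polyhedron (L.map fun t => t.map φ), ∀ w, (¬ ∃ v, φ v = w) → x w = 0 := by
    rintro x ⟨-, -, t, ht, hxt⟩ w hw
    obtain ⟨t, -, rfl⟩ := List.mem_map.1 ht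
    by_contra hne
    obtain ⟨v, -, hv⟩ := List.mem_map.1 (hxt w hne)
    exact hw ⟨v, hv⟩
  have hinv : ∀ x ∈ polyhedron (L.map fun t => t.map φ), x ∘ φ ∈ polyhedron L := by
    intro x hx
    have hz := hzero x hx
    obtain ⟨hx0, hs, t, ht, hxt⟩ := hx
    obtain ⟨t, htL, rfl⟩ := List.mem_map.1 ht
    refine ⟨fun v => hx0 _, ?_, t, htL, fun v hv => ?_⟩
    · rw [← hs]
      exact Fintype.sum_of_injective φ hφ _ _ (fun w hw => hz w hw) fun v => rfl
    · obtain ⟨v', hv', e⟩ := List.mem_map.1 (hxt (φ v) hv)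
      rwa [hφ e] at hv'
  let e : polyhedron L ≃ₜ polyhedron (L.map fun t => t.map φ) :=
    { toFun := fun x => ⟨_, hto x.1 x.2⟩
      invFun := fun x => ⟨_, hinv x.1 x.2⟩
      left_inv := fun x => Subtype.ext (funext fun v => ext_self _ _)
      right_inv := fun x => by
        refine Subtype.ext (funext fun w => ?_)
        by_cases h : ∃ v, φ v = w
        · obtain ⟨v, rfl⟩ := h; exact ext_self _ _
        · exact (ext_zero _ w h).trans (hzero x.1 x.2 w h).symm
      continuous_toFun := by
        refine Continuous.subtype_mk (continuous_pi fun w => ?_) _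
        by_cases h : ∃ v, φ v = w
        · obtain ⟨v, rfl⟩ := h
          simp only [ext_self]
          exact (continuous_apply v).comp continuous_subtype_val
        · simp only [ext_zero _ w h]
          exact continuous_const
      continuous_invFun := by
        refine Continuous.subtype_mk (continuous_pi fun v => ?_) _
        exact (continuous_apply (φ v)).comp continuous_subtype_val }
  exact ⟨e.toHomotopyEquiv⟩

/-! ### Collapsing to a bouquet of four squares -/

/-- The facets of the discrete Morse complex of the triangle, in terms of the arcs enumerated by
`triangleArc`. -/
def triangleMorseFacets : List (List (Fin 9)) :=
  [[0, 1, 8], [1, 2, 6], [0, 2, 7], [3, 4, 6], [4, 5, 7], [3, 5, 8], [0, 3, 8], [1, 4, 6],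
    [2, 5, 7]]

/-- The first of the three vertices other than `9` of the `j`-th square. -/
def corner (j : Fin 4) : Fin 22 := Fin.ofNat 22 (10 + 3 * j.val)

/-- Four squares with the common vertex `9`. -/
def squareBouquet : List (List (Fin 22)) :=
  (List.finRange 4).flatMap fun j =>
    let a := corner j
    [[9, a], [a, a + 1], [a + 1, a + 2], [a + 2, 9]]

/-- The edges of the prism graph outside the spanning path `0, 1, 2, 5, 4, 3`. -/
def chord : Fin 4 → Fin 22 × Fin 22 := ![(0, 2), (3, 5), (0, 3), (1, 4)]

/-- The Morse complex of the triangle, together with a cone with apex `9` over the spanning path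
and, for each chord, a homotopy from the loop through the chord to a square. -/
def commonExpansion : List (List (Fin 22)) :=
  triangleMorseFacets.map (fun t => t.map (Fin.castLE (by decide))) ++
    [[9, 0, 1], [9, 1, 2], [9, 2, 5], [9, 5, 4], [9, 4, 3]] ++
    (List.finRange 4).flatMap fun j =>
      let a := corner j
      let u := (chord j).1
      let v := (chord j).2
      [[9, u, a], [u, a, a + 1], [u, a + 1, v], [v, a + 1, a + 2], [9, v, a + 2]]

/-- Collapses of `commonExpansion` to the Morse complex of the triangle. -/
def collapsesToMorse : List (Fin 22 × Fin 22 × Fin 22) :=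
  ((List.finRange 4).flatMap fun j =>
    let a := corner j
    let u := (chord j).1
    let v := (chord j).2
    [(9, a, u), (a, a, u), (9, a + 2, v), (a + 2, a + 2, v), (a + 1, a + 1, u)]) ++
  [(9, 0, 1), (9, 1, 2), (9, 2, 5), (9, 5, 4), (9, 4, 3), (9, 9, 3)]

/-- Collapses of `commonExpansion` to the bouquet of squares. -/
def collapsesToBouquet : List (Fin 22 × Fin 22 × Fin 22) :=
  [(6, 2, 1), (6, 1, 4), (6, 4, 3), (6, 6, 3), (7, 0, 2), (7, 2, 5), (7, 5, 4), (7, 7, 4),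
    (8, 1, 0), (8, 0, 3), (8, 3, 5), (8, 8, 5)] ++
  ((List.finRange 4).flatMap fun j =>
    let a := corner j
    let u := (chord j).1
    let v := (chord j).2
    [(u, v, a + 1), (u, a + 1, a), (v, a + 1, a + 2), (u, a, 9), (v, a + 2, 9)]) ++
  [(0, 0, 9), (1, 1, 9), (2, 2, 9), (5, 5, 9), (4, 4, 9), (3, 3, 9)]

set_option maxRecDepth 100000 in
theorem commonExpansion_collapsesTo_morse :
    CollapsesTo (triangleMorseFacets.map fun t => t.map (Fin.castLE (by decide : 9 ≤ 22)))
      collapsesToMorse commonExpansion := by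
  decide +kernel

set_option maxRecDepth 100000 in
theorem commonExpansion_collapsesTo_bouquet :
    CollapsesTo squareBouquet collapsesToBouquet commonExpansion := by
  decide +kernel

theorem morseFacets_homotopyEquiv_bouquet :
    Nonempty (ContinuousMap.HomotopyEquiv (polyhedron triangleMorseFacets)
      (polyhedron squareBouquet)) := by
  obtain ⟨e₁⟩ := homotopyEquiv_polyhedron_map (Fin.castLE_injective (by decide : 9 ≤ 22))
    triangleMorseFacets
  obtain ⟨e₂⟩ := commonExpansion_collapsesTo_morse.homotopyEquiv
  obtain ⟨e₃⟩ := commonExpansion_collapsesTo_bouquet.homotopyEquiv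
  exact ⟨(e₁.trans e₂.symm).trans e₃⟩

/-! ### The discrete Morse complexes of the segment and the triangle -/

/-- The subset of `S` left after `n` rounds of removing the elements without successor in `S`. -/
def pruneSinks {α : Type} (R : α → α → Prop) [DecidableRel R] : ℕ → Finset α → Finset α
  | 0, S => S
  | n + 1, S => pruneSinks R n (S.filter fun x => ∃ y ∈ S, R x y)

/-- A relation for which repeated removal of sinks exhausts all elements has no cycles. -/
theorem not_transGen_self_of_pruneSinks {α : Type} {R : α → α → Prop}
    [DecidableRel R] (n : ℕ) :
    ∀ S : Finset α, (∀ x, Relation.TransGen R x x → x ∈ S) → pruneSinks R n S = ∅ →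
      ∀ x, ¬ Relation.TransGen R x x := by
  induction n with
  | zero =>
    intro S hS h x hx
    have hxS := hS x hx
    rw [show S = ∅ from h] at hxS
    exact Finset.notMem_empty x hxS
  | succ n ih =>
    intro S hS h
    refine ih _ (fun x hx => Finset.mem_filter.2 ⟨hS x hx, ?_⟩) h
    obtain ⟨y, hxy, hyx⟩ := Relation.TransGen.head'_iff.1 hx
    exact ⟨y, hS y (Relation.TransGen.tail' hyx hxy), hxy⟩

instance {V : Type} [DecidableEq V] (K : Finset (Finset V)) (g f : Finset V) :
    Decidable (HasseArc K g f) := by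
  unfold HasseArc; infer_instance

instance {V : Type} [DecidableEq V] (K : Finset (Finset V)) (l : List (Finset V × Finset V)) :
    DecidableRel (MorseStep K {p | p ∈ l}) := fun x y =>
  inferInstanceAs (Decidable ((HasseArc K x y ∧ ¬ (x, y) ∈ l) ∨ ((y, x) ∈ l ∧ HasseArc K y x)))

instance {α : Type} [DecidableEq α] (l : List (α × α)) :
    Decidable (IsMatchingPairs {p | p ∈ l}) :=
  inferInstanceAs (Decidable (∀ p ∈ l, ∀ q ∈ l, p ≠ q →
    p.1 ≠ q.1 ∧ p.1 ≠ q.2 ∧ p.2 ≠ q.1 ∧ p.2 ≠ q.2))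

/-- A finite test for being a Morse matching. -/
theorem isMorseMatching_of_pruneSinks {V : Type} [Fintype V] [DecidableEq V]
    {K : Finset (Finset V)} {l : List (Finset V × Finset V)} (n : ℕ)
    (h : (∀ p ∈ l, HasseArc K p.1 p.2) ∧ IsMatchingPairs {p | p ∈ l} ∧
      pruneSinks (MorseStep K {p | p ∈ l}) n Finset.univ = ∅) :
    IsMorseMatching K {p | p ∈ l} :=
  ⟨h.1, h.2.1, not_transGen_self_of_pruneSinks n _ (fun _ _ => Finset.mem_univ _) h.2.2⟩

theorem mem_morseComplex {V : Type} [Fintype V] [DecidableEq V] {K : Finset (Finset V)}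
    {M : Finset (Finset V × Finset V)} :
    M ∈ morseComplex K ↔ M.Nonempty ∧ IsMorseMatching K ↑M := by
  simp [morseComplex]

/-- The arcs of the Hasse diagram of the triangle. -/
def triangleArc : Fin 9 → Finset (Fin 3) × Finset (Fin 3) :=
  ![({0, 1}, {0}), ({1, 2}, {1}), ({0, 2}, {2}), ({1, 2}, {2}), ({0, 2}, {0}), ({0, 1}, {1}),
    ({0, 1, 2}, {0, 1}), ({0, 1, 2}, {1, 2}), ({0, 1, 2}, {0, 2})]

theorem triangleArc_injective : Function.Injective triangleArc := by
  decide +kernel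

theorem exists_triangleArc_eq : ∀ g f : Finset (Fin 3), HasseArc (simplexComplex 2) g f →
    ∃ i, triangleArc i = (g, f) := by
  decide +kernel

set_option maxRecDepth 100000 in
theorem isMorseMatching_sublist_facet : ∀ t ∈ triangleMorseFacets, ∀ l ∈ t.sublists,
    IsMorseMatching (simplexComplex 2) {p | p ∈ l.map triangleArc} := by
  suffices h : ∀ t ∈ triangleMorseFacets, ∀ l ∈ t.sublists,
      (∀ p ∈ l.map triangleArc, HasseArc (simplexComplex 2) p.1 p.2) ∧
        IsMatchingPairs {p | p ∈ l.map triangleArc} ∧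
        pruneSinks (MorseStep (simplexComplex 2) {p | p ∈ l.map triangleArc}) 8 Finset.univ = ∅
    from fun t ht l hl => isMorseMatching_of_pruneSinks 8 (h t ht l hl)
  decide +kernel

/-- In a matching, a path `x, g, y` through an arc of the matching can be continued. -/
theorem IsMorseMatching.step_step {V : Type} [DecidableEq V] {K : Finset (Finset V)}
    {M : Set (Finset V × Finset V)} (hM : IsMorseMatching K M) {x g y : Finset V}
    (hx : (g, x) ∈ M) (hy : HasseArc K g y) (hxy : x ≠ y) :
    Relation.TransGen (MorseStep K M) x y := by
  refine .tail (.single (Or.inr ⟨hx, hM.1 _ hx⟩)) (Or.inl ⟨hy, fun h => ?_⟩)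
  exact (hM.2.1 _ hx _ h (by simpa using hxy)).1 rfl

/-- Two distinct arcs of the triangle that share no endpoint. -/
def ArcsDisjoint (i j : Fin 9) : Prop :=
  i ≠ j → (triangleArc i).1 ≠ (triangleArc j).1 ∧ (triangleArc i).1 ≠ (triangleArc j).2 ∧
    (triangleArc i).2 ≠ (triangleArc j).1 ∧ (triangleArc i).2 ≠ (triangleArc j).2

instance : DecidableRel ArcsDisjoint := fun i j => by unfold ArcsDisjoint; infer_instance

set_option maxRecDepth 100000 in
theorem exists_facet_of_arcsDisjoint : ∀ S : Finset (Fin 9),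
    (∀ i ∈ S, ∀ j ∈ S, ArcsDisjoint i j) → ¬ (0 ∈ S ∧ 1 ∈ S ∧ 2 ∈ S) →
      ¬ (3 ∈ S ∧ 4 ∈ S ∧ 5 ∈ S) → ∃ t ∈ triangleMorseFacets, ∀ i ∈ S, i ∈ t := by
  decide +kernel

theorem mem_morseComplex_triangle {M : Finset (Finset (Fin 3) × Finset (Fin 3))} :
    M ∈ morseComplex (simplexComplex 2) ↔
      M.Nonempty ∧ ∃ t ∈ triangleMorseFacets, ∀ p ∈ M, p ∈ t.map triangleArc := by
  rw [mem_morseComplex]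
  refine and_congr_right fun _ => ⟨fun hM => ?_, ?_⟩
  · obtain ⟨t, ht, hS⟩ := exists_facet_of_arcsDisjoint
      (Finset.univ.filter fun i => triangleArc i ∈ M)
      (fun i hi j hj hij => hM.2.1 _ (Finset.mem_filter.1 hi).2 _ (Finset.mem_filter.1 hj).2
        (triangleArc_injective.ne hij))
      (by
        simp only [Finset.mem_filter_univ]
        rintro ⟨h0, h1, h2⟩
        refine hM.2.2 {0} (((hM.step_step (g := {0, 1}) (y := {1}) h0 ?_ ?_).trans
          (hM.step_step (g := {1, 2}) (y := {2}) h1 ?_ ?_)).trans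
          (hM.step_step (g := {0, 2}) (y := {0}) h2 ?_ ?_)) <;> decide)
      (by
        simp only [Finset.mem_filter_univ]
        rintro ⟨h3, h4, h5⟩
        refine hM.2.2 {2} (((hM.step_step (g := {1, 2}) (y := {1}) h3 ?_ ?_).trans
          (hM.step_step (g := {0, 1}) (y := {0}) h5 ?_ ?_)).trans
          (hM.step_step (g := {0, 2}) (y := {2}) h4 ?_ ?_)) <;> decide)
    refine ⟨t, ht, fun p hp => ?_⟩
    obtain ⟨i, hi⟩ := exists_triangleArc_eq p.1 p.2 (hM.1 p hp)
    exact List.mem_map.2 ⟨i, hS i (by simpa [hi] using hp), hi⟩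
  · rintro ⟨t, ht, hMt⟩
    have : (M : Set (Finset (Fin 3) × Finset (Fin 3))) =
        {p | p ∈ (t.filter fun i => triangleArc i ∈ M).map triangleArc} := by
      ext p
      simp only [Finset.mem_coe, Set.mem_ofPred_eq, List.mem_map, List.mem_filter,
        decide_eq_true_eq]
      refine ⟨fun hp => ?_, ?_⟩
      · obtain ⟨i, hi, rfl⟩ := List.mem_map.1 (hMt p hp)
        exact ⟨i, ⟨hi, hp⟩, rfl⟩
      · rintro ⟨i, ⟨-, hi⟩, rfl⟩
        exact hi
    rw [this]
    exact isMorseMatching_sublist_facet t ht _ (List.mem_sublists.2 List.filter_sublist)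

theorem realization_morseComplex_triangle :
    realization (morseComplex (simplexComplex 2)) =
      polyhedron (triangleMorseFacets.map fun t => t.map triangleArc) := by
  ext x
  refine ⟨?_, ?_⟩
  · rintro ⟨hx, hs, M, hM, hxM⟩
    obtain ⟨-, t, ht, hMt⟩ := mem_morseComplex_triangle.1 hM
    exact ⟨hx, hs, _, List.mem_map.2 ⟨t, ht, rfl⟩, fun v hv => hMt v ((hxM v).1 hv)⟩
  · rintro ⟨hx, hs, _, ht, hxt⟩
    obtain ⟨t, htF, rfl⟩ := List.mem_map.1 ht
    refine ⟨hx, hs, Finset.univ.filter fun v => x v ≠ 0,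
      mem_morseComplex_triangle.2 ⟨?_, t, htF, fun p hp => hxt p (Finset.mem_filter.1 hp).2⟩,
      fun v => by simp⟩
    obtain ⟨v, -, hv⟩ := Finset.exists_ne_zero_of_sum_ne_zero (hs.trans_ne one_ne_zero)
    exact ⟨v, by simpa using hv⟩

/-- The discrete Morse complex of a segment consists of its two arcs. -/
theorem morseComplex_segment : morseComplex (simplexComplex 1) =
    {{(({0, 1} : Finset (Fin 2)), ({0} : Finset (Fin 2)))}, {({0, 1}, {1})}} := by
  have harc : ∀ g f : Finset (Fin 2), HasseArc (simplexComplex 1) g f →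
      g = {0, 1} ∧ (f = {0} ∨ f = {1}) := by decide +kernel
  ext M
  rw [mem_morseComplex, Finset.mem_insert, Finset.mem_singleton]
  refine ⟨fun ⟨⟨p, hp⟩, hM⟩ => ?_, ?_⟩
  · have hsingle : M = {p} := by
      refine Finset.eq_singleton_iff_unique_mem.2 ⟨hp, fun q hq => ?_⟩
      by_contra hne
      refine (hM.2.1 q hq p hp hne).1 ?_
      rw [(harc _ _ (hM.1 q hq)).1, (harc _ _ (hM.1 p hp)).1]
    obtain ⟨g, f⟩ := p
    obtain ⟨rfl, rfl | rfl⟩ := harc _ _ (hM.1 _ hp)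
    · exact Or.inl hsingle
    · exact Or.inr hsingle
  · have key : ∀ p : Finset (Fin 2) × Finset (Fin 2), p = ({0, 1}, {0}) ∨ p = ({0, 1}, {1}) →
        IsMorseMatching (simplexComplex 1) ↑({p} : Finset (Finset (Fin 2) × Finset (Fin 2))) := by
      intro p hp
      have : (↑({p} : Finset (Finset (Fin 2) × Finset (Fin 2))) : Set _) = {q | q ∈ [p]} := by
        ext q; simp
      rw [this]
      refine isMorseMatching_of_pruneSinks 4 ?_
      rcases hp with rfl | rfl <;> decide +kernel
    rintro (rfl | rfl)
    · exact ⟨Finset.singleton_nonempty _, key _ (Or.inl rfl)⟩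
    · exact ⟨Finset.singleton_nonempty _, key _ (Or.inr rfl)⟩

/-! ### Spheres -/

/-- The coordinates of a point of the sphere. -/
noncomputable def sphereCoord {k : ℕ} (z : NSphere k) (i : Fin (k + 1)) : ℝ :=
  (Subtype.val (p := (· ∈ Metric.sphere (0 : EuclideanSpace ℝ (Fin (k + 1))) 1)) z) i

theorem continuous_sphereCoord {k : ℕ} (i : Fin (k + 1)) :
    Continuous fun z : NSphere k => sphereCoord z i :=
  (EuclideanSpace.proj (𝕜 := ℝ) i).continuous.comp continuous_subtype_val

theorem sum_sq_sphereCoord {k : ℕ} (z : NSphere k) : ∑ i, sphereCoord z i ^ 2 = 1 := by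
  have h : ‖z.1‖ = 1 := mem_sphere_zero_iff_norm.1 z.2
  exact (EuclideanSpace.real_norm_sq_eq z.1).symm.trans (by rw [h, one_pow])

theorem sphereCoord_ext {k : ℕ} {z z' : NSphere k} (h : ∀ i, sphereCoord z i = sphereCoord z' i) :
    z = z' :=
  Subtype.ext (PiLp.ext h)

/-- The point of the sphere with given coordinates. -/
noncomputable def sphereMk {k : ℕ} (x : Fin (k + 1) → ℝ) (h : ∑ i, x i ^ 2 = 1) : NSphere k :=
  ⟨WithLp.toLp 2 x, by
    rw [mem_sphere_zero_iff_norm, EuclideanSpace.norm_eq]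
    simp [h]⟩

@[simp]
theorem sphereCoord_sphereMk {k : ℕ} (x : Fin (k + 1) → ℝ) (h : ∑ i, x i ^ 2 = 1)
    (i : Fin (k + 1)) : sphereCoord (sphereMk x h) i = x i :=
  rfl

/-- A complex consisting of two points is a zero-dimensional sphere. -/
theorem homotopyEquiv_realization_two_points {V : Type} [Fintype V] [DecidableEq V] {p q : V}
    (hpq : p ≠ q) :
    Nonempty (ContinuousMap.HomotopyEquiv (realization ({{p}, {q}} : Finset (Finset V)))
      (NSphere 0)) := by
  have hsingle : ∀ (x : V → ℝ) (a : V), ∑ v, x v = 1 → (∀ v, x v ≠ 0 ↔ v ∈ ({a} : Finset V)) →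
      x = Pi.single a 1 := by
    intro x a hs hxa
    have h0 : ∀ v, v ≠ a → x v = 0 := fun v hv => by
      by_contra hne
      exact hv (Finset.mem_singleton.1 ((hxa v).1 hne))
    ext v
    by_cases hv : v = a
    · subst hv
      rw [Fintype.sum_eq_single v h0] at hs
      simpa using hs
    · simp [hv, h0 v hv]
  have hmem : ∀ x : V → ℝ, x ∈ realization ({{p}, {q}} : Finset (Finset V)) ↔
      x = Pi.single p 1 ∨ x = Pi.single q 1 := by
    intro x
    refine ⟨?_, ?_⟩
    · rintro ⟨-, hs, s, hsK, hxs⟩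
      rcases Finset.mem_insert.1 hsK with rfl | h
      · exact Or.inl (hsingle x p hs hxs)
      · rw [Finset.mem_singleton] at h
        subst h
        exact Or.inr (hsingle x q hs hxs)
    · have key : ∀ a : V, {a} ∈ ({{p}, {q}} : Finset (Finset V)) →
          Pi.single a (1 : ℝ) ∈ realization ({{p}, {q}} : Finset (Finset V)) := fun a ha =>
        ⟨fun v => by by_cases hv : v = a <;> simp [hv], by simp, {a}, ha,
          fun v => by simp [Pi.single_apply]⟩
      rintro (rfl | rfl)
      · exact key p (by simp)
      · exact key q (by simp)
  have hval : ∀ x ∈ realization ({{p}, {q}} : Finset (Finset V)), (x p - x q) ^ 2 = 1 := by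
    intro x hx
    rcases (hmem x).1 hx with rfl | rfl <;> simp [hpq, hpq.symm]
  have hinv : ∀ z : NSphere 0, (fun v => (1 + sphereCoord z 0) / 2 * (Pi.single p 1 : V → ℝ) v +
      (1 - sphereCoord z 0) / 2 * (Pi.single q 1 : V → ℝ) v) ∈
        realization ({{p}, {q}} : Finset (Finset V)) := by
    intro z
    have hz : sphereCoord z 0 ^ 2 = 1 := by simpa using sum_sq_sphereCoord z
    rw [hmem]
    rcases sq_eq_one_iff.1 hz with h | h <;> rw [h]
    · left; ext v; norm_num
    · right; ext v; norm_num
  let e : realization ({{p}, {q}} : Finset (Finset V)) ≃ₜ NSphere 0 :=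
    { toFun := fun x => sphereMk (fun _ => x.1 p - x.1 q) (by simpa using hval x.1 x.2)
      invFun := fun z => ⟨_, hinv z⟩
      left_inv := fun x => by
        refine Subtype.ext (funext fun v => ?_)
        rcases (hmem x.1).1 x.2 with h | h <;> simp [h, hpq, hpq.symm]
      right_inv := fun z => by
        refine sphereCoord_ext fun i => ?_
        rw [Fin.fin_one_eq_zero i]
        simp [hpq, hpq.symm]
        ring
      continuous_toFun := by
        refine Continuous.subtype_mk ((PiLp.continuous_toLp 2 _).comp
          (continuous_pi fun _ => ?_)) _
        exact ((continuous_apply p).comp continuous_subtype_val).sub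
          ((continuous_apply q).comp continuous_subtype_val)
      continuous_invFun := by
        refine Continuous.subtype_mk (continuous_pi fun v => ?_) _
        have := continuous_sphereCoord (k := 0) 0
        fun_prop }
  exact ⟨e.toHomotopyEquiv⟩

/-! ### The wedge of four circles as a bouquet of squares -/

/-- The point of the `j`-th square of the bouquet in direction `(c, s)`. -/
noncomputable def squarePoint (j : Fin 4) (c s : ℝ) (i : Fin 22) : ℝ :=
  ((if i = 9 then max c 0 else 0) + (if i = corner j then max s 0 else 0) +
    (if i = corner j + 1 then max (-c) 0 else 0) +
    (if i = corner j + 2 then max (-s) 0 else 0)) / (|c| + |s|)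

theorem corner_distinct : ∀ j : Fin 4, corner j ≠ 9 ∧ corner j + 1 ≠ 9 ∧ corner j + 2 ≠ 9 ∧
    corner j + 1 ≠ corner j ∧ corner j + 2 ≠ corner j ∧ corner j + 2 ≠ corner j + 1 := by
  decide

theorem corner_distinct_of_ne : ∀ j k : Fin 4, j ≠ k → ∀ i : Fin 22,
    i = corner j ∨ i = corner j + 1 ∨ i = corner j + 2 →
      i ≠ 9 ∧ i ≠ corner k ∧ i ≠ corner k + 1 ∧ i ≠ corner k + 2 := by
  decide

theorem squarePoint_nine (j : Fin 4) (c s : ℝ) :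
    squarePoint j c s 9 = max c 0 / (|c| + |s|) := by
  obtain ⟨h1, h2, h3, -⟩ := corner_distinct j
  simp [squarePoint, h1.symm, h2.symm, h3.symm]

theorem squarePoint_corner (j : Fin 4) (c s : ℝ) :
    squarePoint j c s (corner j) = max s 0 / (|c| + |s|) := by
  obtain ⟨h1, -, -, h4, h5, -⟩ := corner_distinct j
  simp [squarePoint, h1, h4.symm, h5.symm]

theorem squarePoint_corner_add_one (j : Fin 4) (c s : ℝ) :
    squarePoint j c s (corner j + 1) = max (-c) 0 / (|c| + |s|) := by
  obtain ⟨-, h2, -, h4, -, h6⟩ := corner_distinct j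
  simp only [squarePoint, h2, h4, h6.symm, if_true, if_false, zero_add, add_zero]

theorem squarePoint_corner_add_two (j : Fin 4) (c s : ℝ) :
    squarePoint j c s (corner j + 2) = max (-s) 0 / (|c| + |s|) := by
  obtain ⟨-, -, h3, -, h5, h6⟩ := corner_distinct j
  simp only [squarePoint, h3, h5, h6, if_true, if_false, zero_add, add_zero]

theorem squarePoint_of_ne {j : Fin 4} {i : Fin 22} (c s : ℝ) (h : i ≠ 9 ∧ i ≠ corner j ∧
    i ≠ corner j + 1 ∧ i ≠ corner j + 2) : squarePoint j c s i = 0 := by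
  simp [squarePoint, h]

theorem max_add_max_neg (c : ℝ) : max c 0 + max (-c) 0 = |c| := by
  rcases le_total 0 c with h | h <;> simp [h, abs_of_nonneg, abs_of_nonpos]

theorem max_sub_max_neg (c : ℝ) : max c 0 - max (-c) 0 = c := by
  rcases le_total 0 c with h | h <;> simp [h]

theorem mem_squareBouquet {t : List (Fin 22)} : t ∈ squareBouquet ↔
    ∃ j, t ∈ [[9, corner j], [corner j, corner j + 1], [corner j + 1, corner j + 2],
      [corner j + 2, 9]] := by
  simp [squareBouquet]

theorem abs_add_abs_pos {c s : ℝ} (h : c ^ 2 + s ^ 2 = 1) : 0 < |c| + |s| := by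
  have h1 := abs_nonneg c
  have h2 := abs_nonneg s
  rw [← sq_abs c, ← sq_abs s] at h
  nlinarith

theorem squarePoint_mem {c s : ℝ} (h : c ^ 2 + s ^ 2 = 1) (j : Fin 4) :
    squarePoint j c s ∈ polyhedron squareBouquet := by
  have hpos := abs_add_abs_pos h
  refine ⟨fun i => ?_, ?_, ?_⟩
  · unfold squarePoint
    refine div_nonneg ?_ hpos.le
    have h0 : ∀ (P : Prop) [Decidable P] (r : ℝ), 0 ≤ if P then max r 0 else 0 := fun P _ r => by
      split_ifs <;> simp
    exact add_nonneg (add_nonneg (add_nonneg (h0 _ _) (h0 _ _)) (h0 _ _)) (h0 _ _)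
  · simp only [squarePoint, ← Finset.sum_div, Finset.sum_add_distrib, Finset.sum_ite_eq',
      Finset.mem_univ, if_true]
    rw [div_eq_one_iff_eq hpos.ne', ← max_add_max_neg c, ← max_add_max_neg s]
    ring
  · have hsupp : ∀ i, squarePoint j c s i ≠ 0 → (i = 9 ∧ 0 < c) ∨ (i = corner j ∧ 0 < s) ∨
        (i = corner j + 1 ∧ c < 0) ∨ (i = corner j + 2 ∧ s < 0) := by
      intro i hi
      contrapose! hi
      obtain ⟨h1, h2, h3, h4⟩ := hi
      have e : ∀ (P : Prop) [Decidable P] (r : ℝ), (P → r ≤ 0) →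
          (if P then max r 0 else 0) = 0 := fun P _ r hr => by
        split_ifs with hP
        · exact max_eq_right (hr hP)
        · rfl
      unfold squarePoint
      rw [e _ _ h1, e _ _ h2, e _ _ fun hi => neg_nonpos.2 (h3 hi),
        e _ _ fun hi => neg_nonpos.2 (h4 hi)]
      simp
    rcases le_total 0 c with hc | hc <;> rcases le_total 0 s with hs | hs
    · refine ⟨[9, corner j], mem_squareBouquet.2 ⟨j, by simp⟩, fun i hi => ?_⟩
      have := hsupp i hi
      simp [hc.not_gt, hs.not_gt] at this ⊢
      tauto
    · refine ⟨[corner j + 2, 9], mem_squareBouquet.2 ⟨j, by simp⟩, fun i hi => ?_⟩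
      have := hsupp i hi
      simp [hc.not_gt, hs.not_gt] at this ⊢
      tauto
    · refine ⟨[corner j, corner j + 1], mem_squareBouquet.2 ⟨j, by simp⟩, fun i hi => ?_⟩
      have := hsupp i hi
      simp [hc.not_gt, hs.not_gt] at this ⊢
      tauto
    · refine ⟨[corner j + 1, corner j + 2], mem_squareBouquet.2 ⟨j, by simp⟩, fun i hi => ?_⟩
      have := hsupp i hi
      simp [hc.not_gt, hs.not_gt] at this ⊢
      tauto

theorem squarePoint_injective {j : Fin 4} {c s c' s' : ℝ} (h : c ^ 2 + s ^ 2 = 1)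
    (h' : c' ^ 2 + s' ^ 2 = 1) (e : squarePoint j c s = squarePoint j c' s') :
    c = c' ∧ s = s' := by
  have hn := abs_add_abs_pos h
  have hn' := abs_add_abs_pos h'
  have e0 := congrFun e 9
  have e1 := congrFun e (corner j)
  have e2 := congrFun e (corner j + 1)
  have e3 := congrFun e (corner j + 2)
  rw [squarePoint_nine, squarePoint_nine] at e0
  rw [squarePoint_corner, squarePoint_corner] at e1
  rw [squarePoint_corner_add_one, squarePoint_corner_add_one] at e2
  rw [squarePoint_corner_add_two, squarePoint_corner_add_two] at e3
  have ec : c / (|c| + |s|) = c' / (|c'| + |s'|) := by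
    rw [← max_sub_max_neg c, ← max_sub_max_neg c', sub_div, sub_div,
      max_sub_max_neg, max_sub_max_neg, e0, e2]
  have es : s / (|c| + |s|) = s' / (|c'| + |s'|) := by
    rw [← max_sub_max_neg s, ← max_sub_max_neg s', sub_div, sub_div,
      max_sub_max_neg, max_sub_max_neg, e1, e3]
  generalize |c| + |s| = n at *
  generalize |c'| + |s'| = n' at *
  rw [div_eq_div_iff hn.ne' hn'.ne'] at ec es
  have hsq : n' ^ 2 = n ^ 2 := by
    calc n' ^ 2 = (c * n') ^ 2 + (s * n') ^ 2 := by linear_combination -n' ^ 2 * h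
      _ = (c' * n) ^ 2 + (s' * n) ^ 2 := by rw [ec, es]
      _ = n ^ 2 := by linear_combination n ^ 2 * h'
  have hnn : n' = n := by
    rwa [sq_eq_sq₀ hn'.le hn.le] at hsq
  subst hnn
  exact ⟨mul_right_cancel₀ hn.ne' ec, mul_right_cancel₀ hn.ne' es⟩

theorem eq_base_of_squarePoint_eq {j k : Fin 4} (hjk : j ≠ k) {c s c' s' : ℝ}
    (h : c ^ 2 + s ^ 2 = 1) (e : squarePoint j c s = squarePoint k c' s') :
    c = 1 ∧ s = 0 := by
  have hn := abs_add_abs_pos h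
  have hd := corner_distinct_of_ne j k hjk
  have e1 := congrFun e (corner j)
  have e2 := congrFun e (corner j + 1)
  have e3 := congrFun e (corner j + 2)
  rw [squarePoint_of_ne c' s' (hd _ (Or.inl rfl)), squarePoint_corner, div_eq_zero_iff,
    or_iff_left hn.ne', max_eq_right_iff] at e1
  rw [squarePoint_of_ne c' s' (hd _ (Or.inr (Or.inl rfl))), squarePoint_corner_add_one,
    div_eq_zero_iff, or_iff_left hn.ne', max_eq_right_iff] at e2
  rw [squarePoint_of_ne c' s' (hd _ (Or.inr (Or.inr rfl))), squarePoint_corner_add_two,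
    div_eq_zero_iff, or_iff_left hn.ne', max_eq_right_iff] at e3
  have hs : s = 0 := by linarith
  subst hs
  refine ⟨?_, rfl⟩
  nlinarith

theorem squarePoint_div {m : ℝ} (hm : 0 < m) (j : Fin 4) (c s : ℝ) :
    squarePoint j (c / m) (s / m) = squarePoint j c s := by
  have e : ∀ r : ℝ, max (r / m) 0 = max r 0 / m := fun r => by
    rw [← max_div_div_right hm.le, zero_div]
  have e' : ∀ (P : Prop) [Decidable P] (r : ℝ),
      (if P then r / m else 0) = (if P then r else 0) / m := fun P _ r => by
    split_ifs <;> simp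
  ext i
  simp only [squarePoint, abs_div, abs_of_pos hm, ← neg_div, e, e', ← add_div]
  exact div_div_div_cancel_right₀ hm.ne' _ _

theorem exists_squarePoint_eq {x : Fin 22 → ℝ} (hx : x ∈ polyhedron squareBouquet) :
    ∃ j c s, c ^ 2 + s ^ 2 = 1 ∧ squarePoint j c s = x := by
  obtain ⟨hx0, hsum, t, ht, hxt⟩ := hx
  obtain ⟨j, ht⟩ := mem_squareBouquet.1 ht
  obtain ⟨d1, d2, d3, d4, d5, d6⟩ := corner_distinct j
  have hzero : ∀ i, i ∉ t → x i = 0 := fun i hi => by_contra fun hne => hi (hxt i hne)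
  have hvert : ∀ i ∈ t, i = 9 ∨ i = corner j ∨ i = corner j + 1 ∨ i = corner j + 2 := by
    intro i hi
    simp only [List.mem_cons, List.not_mem_nil, or_false] at ht
    rcases ht with rfl | rfl | rfl | rfl <;>
      simp only [List.mem_cons, List.not_mem_nil, or_false] at hi <;> tauto
  have hopp : (x 9 = 0 ∨ x (corner j + 1) = 0) ∧ (x (corner j) = 0 ∨ x (corner j + 2) = 0) := by
    simp only [List.mem_cons, List.not_mem_nil, or_false] at ht
    rcases ht with rfl | rfl | rfl | rfl
    · exact ⟨Or.inr (hzero _ (by simp [d2, d4])), Or.inr (hzero _ (by simp [d3, d5]))⟩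
    · exact ⟨Or.inl (hzero _ (by simp [d1.symm, d2.symm])), Or.inr (hzero _ (by simp [d5, d6]))⟩
    · exact ⟨Or.inl (hzero _ (by simp [d2.symm, d3.symm])),
        Or.inl (hzero _ (by simp [d4.symm, d5.symm]))⟩
    · exact ⟨Or.inr (hzero _ (by simp [d6.symm, d2])), Or.inl (hzero _ (by simp [d5.symm, d1]))⟩
  have hsum4 : x 9 + x (corner j) + x (corner j + 1) + x (corner j + 2) = 1 := by
    rw [← hsum, ← Finset.sum_subset (Finset.subset_univ {9, corner j, corner j + 1, corner j + 2})]
    · rw [Finset.sum_insert, Finset.sum_insert, Finset.sum_insert, Finset.sum_singleton]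
      · ring
      · simp [d6.symm]
      · simp [d4.symm, d5.symm]
      · simp [d1.symm, d2.symm, d3.symm]
    · intro i _ hi
      refine hzero i fun hit => hi ?_
      simpa using hvert i hit
  have hmax : ∀ a b : ℝ, 0 ≤ a → 0 ≤ b → a = 0 ∨ b = 0 →
      max (a - b) 0 = a ∧ max (-(a - b)) 0 = b := by
    rintro a b ha hb (rfl | rfl)
    · simp [hb]
    · simp [ha]
  obtain ⟨hc, hc'⟩ := hmax _ _ (hx0 9) (hx0 (corner j + 1)) hopp.1
  obtain ⟨hs, hs'⟩ := hmax _ _ (hx0 (corner j)) (hx0 (corner j + 2)) hopp.2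
  have hn : |x 9 - x (corner j + 1)| + |x (corner j) - x (corner j + 2)| = 1 := by
    rw [← max_add_max_neg, ← max_add_max_neg, hc, hc', hs, hs', ← hsum4]
    ring
  have hpoint : squarePoint j (x 9 - x (corner j + 1)) (x (corner j) - x (corner j + 2)) = x := by
    ext i
    by_cases h0 : i = 9
    · rw [h0, squarePoint_nine, hn, hc, div_one]
    by_cases h1 : i = corner j
    · rw [h1, squarePoint_corner, hn, hs, div_one]
    by_cases h2 : i = corner j + 1
    · rw [h2, squarePoint_corner_add_one, hn, hc', div_one]
    by_cases h3 : i = corner j + 2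
    · rw [h3, squarePoint_corner_add_two, hn, hs', div_one]
    rw [squarePoint_of_ne _ _ ⟨h0, h1, h2, h3⟩, hzero i fun hit => ?_]
    have := hvert i hit
    tauto
  generalize x 9 - x (corner j + 1) = c at *
  generalize x (corner j) - x (corner j + 2) = s at *
  have hpos : 0 < c ^ 2 + s ^ 2 := by
    by_contra hle
    have h1 : c = 0 := by nlinarith [sq_nonneg c, sq_nonneg s]
    have h2 : s = 0 := by nlinarith [sq_nonneg c, sq_nonneg s]
    simp [h1, h2] at hn
  refine ⟨j, c / √(c ^ 2 + s ^ 2), s / √(c ^ 2 + s ^ 2), ?_, ?_⟩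
  · rw [div_pow, div_pow, Real.sq_sqrt hpos.le, ← add_div, div_self hpos.ne']
  · rw [squarePoint_div (Real.sqrt_pos.2 hpos), hpoint]

theorem sq_add_sq_sphereCoord (z : NSphere 1) :
    sphereCoord z 0 ^ 2 + sphereCoord z 1 ^ 2 = 1 := by
  simpa [Fin.sum_univ_two] using sum_sq_sphereCoord z

/-- The homeomorphism from the circle to the `j`-th square of the bouquet. -/
noncomputable def squareLoop (j : Fin 4) (z : NSphere 1) : polyhedron squareBouquet :=
  ⟨squarePoint j (sphereCoord z 0) (sphereCoord z 1), squarePoint_mem (sq_add_sq_sphereCoord z) j⟩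

theorem continuous_squareLoop (j : Fin 4) : Continuous (squareLoop j) := by
  refine Continuous.subtype_mk (continuous_pi fun i => ?_) _
  have hc := continuous_sphereCoord (k := 1) 0
  have hs := continuous_sphereCoord (k := 1) 1
  refine Continuous.div ?_ (hc.abs.add hs.abs)
    fun z => (abs_add_abs_pos (sq_add_sq_sphereCoord z)).ne'
  have h0 : ∀ (P : Prop) [Decidable P] {f : NSphere 1 → ℝ}, Continuous f →
      Continuous fun z => if P then max (f z) 0 else 0 := fun P _ f hf => by
    split_ifs
    · exact hf.max continuous_const
    · exact continuous_const
  exact (((h0 _ hc).add (h0 _ hs)).add (h0 _ hc.neg)).add (h0 _ hs.neg)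

/-- The base point of the circle. -/
noncomputable def circleBase : NSphere 1 := sphereMk ![1, 0] (by simp)

theorem eq_circleBase {z : NSphere 1} (h : sphereCoord z 0 = 1 ∧ sphereCoord z 1 = 0) :
    z = circleBase := by
  refine sphereCoord_ext fun i => ?_
  fin_cases i
  · exact h.1
  · exact h.2

theorem squareLoop_circleBase (j k : Fin 4) :
    squareLoop j circleBase = squareLoop k circleBase := by
  refine Subtype.ext (funext fun i => ?_)
  simp [squareLoop, squarePoint, circleBase]

/-- The wedge of four circles. -/
abbrev CircleWedge : Type :=
  Wedge4 (NSphere 1) (NSphere 1) (NSphere 1) (NSphere 1) circleBase circleBase circleBase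
    circleBase

/-- The inclusion of the `j`-th circle into the wedge. -/
def CircleWedge.incl (j : Fin 4) (z : NSphere 1) : CircleWedge :=
  Quot.mk _ (![Sum.inl z, Sum.inr (Sum.inl z), Sum.inr (Sum.inr (Sum.inl z)),
    Sum.inr (Sum.inr (Sum.inr z))] j)

theorem CircleWedge.exists_incl_eq (q : CircleWedge) : ∃ j z, incl j z = q := by
  obtain ⟨y, rfl⟩ := Quot.exists_rep q
  rcases y with z | z | z | z
  · exact ⟨0, z, rfl⟩
  · exact ⟨1, z, rfl⟩
  · exact ⟨2, z, rfl⟩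
  · exact ⟨3, z, rfl⟩

theorem CircleWedge.incl_circleBase (j : Fin 4) : incl j circleBase = incl 0 circleBase := by
  fin_cases j
  · rfl
  · refine Eq.symm (Quot.sound ?_); exact Or.inl ⟨rfl, rfl⟩
  · refine Eq.symm (Quot.sound ?_); exact Or.inr (Or.inl ⟨rfl, rfl⟩)
  · refine Eq.symm (Quot.sound ?_); exact Or.inr (Or.inr ⟨rfl, rfl⟩)

/-- The map from the wedge of circles to the bouquet of squares. -/
noncomputable def wedgeToBouquet : CircleWedge → polyhedron squareBouquet :=
  Quot.lift (Sum.elim (squareLoop 0) (Sum.elim (squareLoop 1)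
    (Sum.elim (squareLoop 2) (squareLoop 3)))) (by
    rintro _ _ (⟨rfl, rfl⟩ | ⟨rfl, rfl⟩ | ⟨rfl, rfl⟩) <;> exact squareLoop_circleBase _ _)

theorem continuous_wedgeToBouquet : Continuous wedgeToBouquet :=
  continuous_quot_lift _ ((continuous_squareLoop 0).sumElim ((continuous_squareLoop 1).sumElim
    ((continuous_squareLoop 2).sumElim (continuous_squareLoop 3))))

theorem wedgeToBouquet_incl (j : Fin 4) (z : NSphere 1) :
    wedgeToBouquet (CircleWedge.incl j z) = squareLoop j z := by
  fin_cases j <;> rfl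

theorem wedgeToBouquet_bijective : Function.Bijective wedgeToBouquet := by
  refine ⟨fun q q' h => ?_, fun x => ?_⟩
  · obtain ⟨j, z, rfl⟩ := q.exists_incl_eq
    obtain ⟨k, z', rfl⟩ := q'.exists_incl_eq
    rw [wedgeToBouquet_incl, wedgeToBouquet_incl] at h
    have e := congrArg Subtype.val h
    have hz := sq_add_sq_sphereCoord z
    have hz' := sq_add_sq_sphereCoord z'
    by_cases hjk : j = k
    · subst hjk
      obtain ⟨h0, h1⟩ := squarePoint_injective hz hz' e
      congr 1
      refine sphereCoord_ext fun i => ?_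
      fin_cases i
      · exact h0
      · exact h1
    · rw [eq_circleBase (eq_base_of_squarePoint_eq hjk hz e),
        eq_circleBase (eq_base_of_squarePoint_eq (Ne.symm hjk) hz' e.symm),
        CircleWedge.incl_circleBase, CircleWedge.incl_circleBase k]
  · obtain ⟨j, c, s, hcs, hx⟩ := exists_squarePoint_eq x.2
    exact ⟨CircleWedge.incl j (sphereMk ![c, s] (by simpa [Fin.sum_univ_two] using hcs)),
      (wedgeToBouquet_incl _ _).trans (Subtype.ext hx)⟩

theorem circleWedge_homotopyEquiv_bouquet :
    Nonempty (ContinuousMap.HomotopyEquiv CircleWedge (polyhedron squareBouquet)) := by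
  have : CompactSpace (NSphere 1) := inferInstanceAs
    (CompactSpace (Metric.sphere (0 : EuclideanSpace ℝ (Fin (1 + 1))) 1))
  have : CompactSpace CircleWedge := inferInstanceAs (CompactSpace (Quot _))
  exact ⟨(continuous_wedgeToBouquet.homeoOfEquivCompactToT2
    (f := Equiv.ofBijective _ wedgeToBouquet_bijective)).toHomotopyEquiv⟩

/-- the discrete Morse complex of the `2`-simplex is homotopy equivalent to
a wedge of four circles, and the discrete Morse complex of the `1`-simplex consists of
exactly two points, i.e. is homotopy equivalent to `S^0`. -/
theorem morse_complex_of_small_simplices :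
    (∃ (a b c d : NSphere 1),
      Nonempty (ContinuousMap.HomotopyEquiv
        (↥(realization (morseComplex (simplexComplex 2))))
        (Wedge4 (NSphere 1) (NSphere 1) (NSphere 1) (NSphere 1) a b c d))) ∧
    ((morseComplex (simplexComplex 1)).card = 2 ∧
      (∀ s ∈ morseComplex (simplexComplex 1), s.card = 1) ∧
      Nonempty (ContinuousMap.HomotopyEquiv
        (↥(realization (morseComplex (simplexComplex 1)))) (NSphere 0))) := by
  obtain ⟨e₁⟩ := homotopyEquiv_polyhedron_map triangleArc_injective triangleMorseFacets
  obtain ⟨e₂⟩ := morseFacets_homotopyEquiv_bouquet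
  obtain ⟨e₃⟩ := circleWedge_homotopyEquiv_bouquet
  refine ⟨⟨circleBase, circleBase, circleBase, circleBase, ?_⟩, ?_, ?_, ?_⟩
  · rw [realization_morseComplex_triangle]
    exact ⟨(e₁.symm.trans e₂).trans e₃.symm⟩
  · rw [morseComplex_segment]
    exact Finset.card_pair (by decide)
  · rw [morseComplex_segment]
    simp
  · rw [morseComplex_segment]
    exact homotopyEquiv_realization_two_points (by decide)
end

section
/- Let μ and μ′ be perfect Morse matchings of the (n−1)-dimensional simplex Δ_{n−1}, and for 0 ≤ k ≤ n−1 let T_k(μ) be the set of k-dimensional faces matched by μ to a (k−1)-dimensional face, and likewise T_k(μ′). If T_k(μ) = T_k(μ′) for all k with 0 ≤ k ≤ n−1, then μ = μ′. -/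
open Finset

/-- A perfect Morse matching on `K`: a Morse matching covering every face of `K`. -/
def IsPerfectMorseMatching {V : Type} [DecidableEq V] (K : Finset (Finset V))
    (M : Set (Finset V × Finset V)) : Prop :=
  IsMorseMatching K M ∧ ∀ s ∈ K, ∃ p ∈ M, p.1 = s ∨ p.2 = s

/-- The simplex on the vertex set `Fin n`, with all subsets (including the empty set,
the face of dimension `-1`) as faces; this is the `(n-1)`-dimensional simplex `Δ_{n-1}`. -/
def fullSimplex (n : ℕ) : Finset (Finset (Fin n)) :=
  (Finset.univ : Finset (Fin n)).powerset

/-- A face matched downward by one perfect Morse matching is matched to the same face by any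
other perfect Morse matching with the same downward matched faces. -/
theorem IsPerfectMorseMatching.subset_of_matched_down_iff {V : Type} [DecidableEq V] [Finite V]
    {K : Finset (Finset V)} {M N : Set (Finset V × Finset V)}
    (hM : IsPerfectMorseMatching K M) (hN : IsPerfectMorseMatching K N)
    (h : ∀ s, (∃ f, (s, f) ∈ M) ↔ ∃ f, (s, f) ∈ N) : M ⊆ N := by
  obtain ⟨⟨arcM, matchM, acyclicM⟩, -⟩ := hM
  obtain ⟨⟨arcN, matchN, -⟩, coverN⟩ := hN
  have : Std.Irrefl (Relation.TransGen (MorseStep K M)) := ⟨acyclicM⟩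
  have wf : WellFounded (Relation.TransGen (MorseStep K M)) :=
    Finite.wellFounded_of_trans_of_irrefl _
  suffices ∀ g f, (g, f) ∈ M → (g, f) ∈ N from fun p hp => this p.1 p.2 hp
  intro g
  induction g using wf.induction with
  | _ g ih =>
    intro f hgf
    have not_down : ∀ e, (f, e) ∉ M := fun e he => by
      by_cases heq : ((g, f) : Finset V × Finset V) = (f, e)
      · have hlt := (arcM _ hgf).2.2.1
        exact hlt.ne (congrArg Prod.fst heq).symm
      · exact (matchM _ hgf _ he heq).2.2.1 rfl
    obtain ⟨⟨g', f₀⟩, hg', hf | hf⟩ := coverN f (arcM _ hgf).2.1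
    · obtain rfl : g' = f := hf
      obtain ⟨e, he⟩ := (h g').2 ⟨f₀, hg'⟩
      exact absurd he (not_down e)
    obtain rfl : f₀ = f := hf
    by_cases hne : g' = g
    · exact hne ▸ hg'
    have hnot : (g', f₀) ∉ M := fun hmem =>
      (matchM _ hmem _ hgf fun heq => hne (congrArg Prod.fst heq)).2.2.2 rfl
    obtain ⟨f', hf'⟩ := (h g').2 ⟨f₀, hg'⟩
    have hstep : Relation.TransGen (MorseStep K M) g' g :=
      .tail (.single (.inl ⟨arcN _ hg', hnot⟩)) (.inr ⟨hgf, arcM _ hgf⟩)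
    have hN' := ih g' hstep f' hf'
    have hff : f' = f₀ := by
      by_contra hff
      exact (matchN _ hN' _ hg' fun heq => hff (congrArg Prod.snd heq)).1 rfl
    exact absurd (hff ▸ hf') hnot

/-- a perfect Morse matching `μ` of `Δ_{n-1}` is determined by the sequence
of sets `T_k(μ)` of `k`-dimensional faces matched downward: if `T_k(μ) = T_k(μ')` for all
`0 ≤ k ≤ n - 1`, then `μ = μ'`. -/
theorem perfect_morse_matching_determined_by_trees (n : ℕ)
    (μ μ' : Set (Finset (Fin n) × Finset (Fin n)))
    (hμ : IsPerfectMorseMatching (fullSimplex n) μ)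
    (hμ' : IsPerfectMorseMatching (fullSimplex n) μ')
    (hT : ∀ k ≤ n - 1,
      {s : Finset (Fin n) | s.card = k + 1 ∧ ∃ f, (s, f) ∈ μ} =
      {s : Finset (Fin n) | s.card = k + 1 ∧ ∃ f, (s, f) ∈ μ'}) :
    μ = μ' := by
  have matched_down_iff : ∀ s, (∃ f, (s, f) ∈ μ) ↔ ∃ f, (s, f) ∈ μ' := by
    intro s
    have hn : s.card ≤ n := by simpa using s.card_le_univ
    constructor
    · rintro ⟨f, hf⟩
      have hc : s.card = f.card + 1 := (hμ.1.1 _ hf).2.2.2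
      exact ((Set.ext_iff.1 (hT f.card (by omega)) s).1 ⟨hc, f, hf⟩).2
    · rintro ⟨f, hf⟩
      have hc : s.card = f.card + 1 := (hμ'.1.1 _ hf).2.2.2
      exact ((Set.ext_iff.1 (hT f.card (by omega)) s).2 ⟨hc, f, hf⟩).2
  exact (hμ.subset_of_matched_down_iff hμ' matched_down_iff).antisymm
    (hμ'.subset_of_matched_down_iff hμ fun s => (matched_down_iff s).symm)
end

section
/- For every n ≥ 1, the number f(n) of perfect Morse matchings of the n-dimensional simplex Δ_n satisfies f(n) ≤ (n+1)^{2^{n−1}}. -/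
open Finset

open Matrix

namespace PerfectMorse

/-! ### A determinantal counting bound -/

section Gram

variable {m k : Type*} [Fintype m] [DecidableEq m] [Fintype k]

/-- The Cauchy–Binet formula for a Gram determinant, summed over all functions instead of over
subsets of columns. -/
theorem sum_sq_det_submatrix (W : Matrix m k ℤ) :
    ∑ f : m → k, (W.submatrix id f).det ^ 2 =
      ((Fintype.card m).factorial : ℤ) * (W * Wᵀ).det := by
  have h (σ : Equiv.Perm m) :
      ∑ τ : Equiv.Perm m, ((Equiv.Perm.sign σ : ℤ) * (Equiv.Perm.sign τ : ℤ)) *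
        ∏ i, (W * Wᵀ) (σ i) (τ i) = (W * Wᵀ).det := by
    have h₁ := Matrix.det_permute σ (W * Wᵀ)
    have h₂ : ((Equiv.Perm.sign σ : ℤ)) * (Equiv.Perm.sign σ : ℤ) = 1 := by
      rw [← Units.val_mul, Int.units_mul_self, Units.val_one]
    rw [← Matrix.det_transpose, Matrix.det_apply'] at h₁
    simp only [mul_assoc]
    rw [← Finset.mul_sum]
    simp only [Matrix.transpose_apply, Matrix.submatrix_apply, id] at h₁
    simp only [Int.cast_id] at h₁
    rw [h₁, ← mul_assoc, h₂, one_mul]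
  calc ∑ f : m → k, (W.submatrix id f).det ^ 2
      = ∑ f : m → k, ∑ σ : Equiv.Perm m, ∑ τ : Equiv.Perm m,
          ((Equiv.Perm.sign σ : ℤ) * (Equiv.Perm.sign τ : ℤ)) *
            ∏ i, W (σ i) (f i) * W (τ i) (f i) := by
        refine Finset.sum_congr rfl fun f _ => ?_
        rw [sq, Matrix.det_apply', Finset.sum_mul_sum]
        refine Finset.sum_congr rfl fun σ _ => Finset.sum_congr rfl fun τ _ => ?_
        simp only [Matrix.submatrix_apply, id, Finset.prod_mul_distrib, Int.cast_id]
        ring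
    _ = ∑ σ : Equiv.Perm m, ∑ τ : Equiv.Perm m,
          ((Equiv.Perm.sign σ : ℤ) * (Equiv.Perm.sign τ : ℤ)) *
            ∏ i, (W * Wᵀ) (σ i) (τ i) := by
        rw [Finset.sum_comm]
        refine Finset.sum_congr rfl fun σ _ => ?_
        rw [Finset.sum_comm]
        refine Finset.sum_congr rfl fun τ _ => ?_
        simp only [Matrix.mul_apply, Matrix.transpose_apply]
        rw [← Finset.mul_sum, Finset.prod_univ_sum, Fintype.piFinset_univ]
    _ = _ := by
        simp only [h, Finset.sum_const, Finset.card_univ, Fintype.card_perm, nsmul_eq_mul]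

theorem det_mul_transpose_nonneg (W : Matrix m k ℤ) : 0 ≤ (W * Wᵀ).det := by
  have h := sum_sq_det_submatrix W
  have h₀ : 0 ≤ ∑ f : m → k, (W.submatrix id f).det ^ 2 :=
    Finset.sum_nonneg fun f _ => sq_nonneg _
  rw [h] at h₀
  exact nonneg_of_mul_nonneg_right h₀ (by exact_mod_cast Nat.factorial_pos _)

/-- The number of sets of columns spanning a nonsingular square submatrix is at most the Gram
determinant. -/
theorem card_le_det_mul_transpose [DecidableEq k] (W : Matrix m k ℤ) (S : Finset (Finset k))
    (hS : ∀ B ∈ S, ∃ b : m → k, Function.Injective b ∧ Finset.univ.image b = B ∧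
      (W.submatrix id b).det ≠ 0) :
    (S.card : ℤ) ≤ (W * Wᵀ).det := by
  rcases S.eq_empty_or_nonempty with rfl | ⟨B₀, hB₀⟩
  · simpa using det_mul_transpose_nonneg W
  have : Nonempty (m → k) := ⟨(hS B₀ hB₀).choose⟩
  choose! b hb himg hdet using hS
  have hinj : Set.InjOn (fun p : Finset k × Equiv.Perm m => b p.1 ∘ p.2)
      (S ×ˢ (Finset.univ : Finset (Equiv.Perm m)) : Finset _) := by
    rintro ⟨B, σ⟩ hB ⟨B', σ'⟩ hB' h
    simp only [Finset.coe_product, Set.mem_prod, Finset.mem_coe, Finset.mem_univ, and_true]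
      at hB hB'
    dsimp only at h
    have himage (C : Finset k) (τ : Equiv.Perm m) :
        Finset.univ.image (b C ∘ τ) = Finset.univ.image (b C) := by
      ext x
      simp only [Finset.mem_image, Finset.mem_univ, true_and, Function.comp]
      exact τ.exists_congr_left.trans (by simp)
    have hBB : B = B' := by
      rw [← himg B hB, ← himg B' hB', ← himage B σ, ← himage B' σ', h]
    subst hBB
    refine Prod.ext rfl (Equiv.ext fun i => hb B hB ?_)
    exact congrFun h i
  have hle : ((Fintype.card m).factorial : ℤ) * S.card ≤
      ((Fintype.card m).factorial : ℤ) * (W * Wᵀ).det := by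
    rw [← sum_sq_det_submatrix]
    calc ((Fintype.card m).factorial : ℤ) * S.card
        = ∑ p ∈ S ×ˢ (Finset.univ : Finset (Equiv.Perm m)), (1 : ℤ) := by
          simp [Fintype.card_perm, mul_comm]
      _ ≤ ∑ p ∈ S ×ˢ (Finset.univ : Finset (Equiv.Perm m)),
            (W.submatrix id (b p.1 ∘ p.2)).det ^ 2 := by
          refine Finset.sum_le_sum fun p hp => ?_
          have hp' := hdet p.1 (Finset.mem_product.1 hp).1
          have h₁ := Matrix.det_permute' p.2 (W.submatrix id (b p.1))
          rw [Matrix.submatrix_submatrix] at h₁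
          have h₂ : (W.submatrix id (b p.1 ∘ p.2)).det ≠ 0 := by
            rw [show (id : m → m) = id ∘ id from rfl, h₁]
            exact mul_ne_zero (by simp) hp'
          have : 0 < (W.submatrix id (b p.1 ∘ p.2)).det ^ 2 := by positivity
          omega
      _ = ∑ f ∈ (S ×ˢ (Finset.univ : Finset (Equiv.Perm m))).image
            (fun p => b p.1 ∘ p.2), (W.submatrix id f).det ^ 2 := by
          rw [Finset.sum_image hinj]
      _ ≤ _ := Finset.sum_le_sum_of_subset_of_nonneg (Finset.subset_univ _)
          fun f _ _ => sq_nonneg _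
  exact le_of_mul_le_mul_left hle (by exact_mod_cast Nat.factorial_pos _)

end Gram

/-! ### The boundary matrix of the simplex -/

/-- Faces of the simplex on `Fin (n + 1)`, split according to whether they avoid (`inl`) or
contain (`inr`) the vertex `0`. -/
def extendFace (n : ℕ) : Finset (Fin n) ⊕ Finset (Fin n) → Finset (Fin (n + 1))
  | .inl s => s.map (Fin.succEmb n)
  | .inr s => Finset.cons 0 (s.map (Fin.succEmb n)) (by simp)

theorem extendFace_bijective (n : ℕ) : Function.Bijective (extendFace n) := by
  rw [Fintype.bijective_iff_injective_and_card]
  constructor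
  · have h0 (s : Finset (Fin n)) : (0 : Fin (n + 1)) ∉ s.map (Fin.succEmb n) := by simp
    rintro (s | s) (t | t) h <;> simp only [extendFace] at h
    · exact congrArg _ (Finset.map_injective _ h)
    · exact absurd (h ▸ Finset.mem_cons_self _ _) (h0 s)
    · exact absurd (h ▸ Finset.mem_cons_self _ _) (h0 t)
    · refine congrArg _ (Finset.map_injective (Fin.succEmb n) ?_)
      rw [Finset.cons_eq_insert, Finset.cons_eq_insert] at h
      rw [← Finset.erase_insert (h0 s), h, Finset.erase_insert (h0 t)]
  · simp [pow_succ, mul_two]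

/-- The bijection underlying `extendFace`. -/
noncomputable def faceEquiv (n : ℕ) :
    Finset (Fin n) ⊕ Finset (Fin n) ≃ Finset (Fin (n + 1)) :=
  Equiv.ofBijective _ (extendFace_bijective n)

/-- The boundary matrix of the full simplex in all dimensions at once, the empty face included:
the simplex on `Fin (n + 1)` is the cone with apex `0` over the simplex on `Fin n`. -/
noncomputable def boundaryMatrix : (n : ℕ) → Matrix (Finset (Fin n)) (Finset (Fin n)) ℤ
  | 0 => 0
  | n + 1 => (Matrix.fromBlocks (boundaryMatrix n) 1 0 (-boundaryMatrix n)).submatrix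
      (faceEquiv n).symm (faceEquiv n).symm

theorem boundaryMatrix_mul_self (n : ℕ) : boundaryMatrix n * boundaryMatrix n = 0 := by
  induction n with
  | zero => simp [boundaryMatrix]
  | succ n ih =>
    rw [boundaryMatrix, Matrix.submatrix_mul_equiv, Matrix.fromBlocks_multiply]
    simp [ih]

theorem boundaryMatrix_laplacian (n : ℕ) :
    boundaryMatrix n * (boundaryMatrix n)ᵀ + (boundaryMatrix n)ᵀ * boundaryMatrix n =
      (n : ℤ) • (1 : Matrix (Finset (Fin n)) (Finset (Fin n)) ℤ) := by
  induction n with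
  | zero => simp [boundaryMatrix]
  | succ n ih =>
    rw [boundaryMatrix, Matrix.transpose_submatrix, Matrix.submatrix_mul_equiv,
      Matrix.submatrix_mul_equiv, Matrix.fromBlocks_transpose, Matrix.fromBlocks_multiply,
      Matrix.fromBlocks_multiply, ← Matrix.submatrix_one_equiv (faceEquiv n).symm,
      ← Matrix.fromBlocks_one]
    have h : ∀ A B : Matrix (Finset (Fin n) ⊕ Finset (Fin n)) (Finset (Fin n) ⊕ Finset (Fin n)) ℤ,
        A.submatrix (faceEquiv n).symm (faceEquiv n).symm +
          B.submatrix (faceEquiv n).symm (faceEquiv n).symm =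
        (A + B).submatrix (faceEquiv n).symm (faceEquiv n).symm := fun _ _ => rfl
    have hsmul : ∀ (c : ℤ)
        (A : Matrix (Finset (Fin n) ⊕ Finset (Fin n)) (Finset (Fin n) ⊕ Finset (Fin n)) ℤ),
        c • A.submatrix (faceEquiv n).symm (faceEquiv n).symm =
        (c • A).submatrix (faceEquiv n).symm (faceEquiv n).symm := fun _ _ => rfl
    rw [h, hsmul, Matrix.fromBlocks_add, Matrix.fromBlocks_smul]
    congr 1
    simp only [Matrix.transpose_one, Matrix.transpose_zero, Matrix.transpose_neg, mul_one, one_mul,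
      mul_zero, zero_mul, Matrix.mul_neg, Matrix.neg_mul, neg_neg, add_zero, zero_add, smul_zero,
      neg_add_cancel, Nat.cast_succ, add_smul, one_smul, ← ih]
    congr 1 <;> abel

theorem boundaryMatrix_ne_zero_iff (n : ℕ) (s t : Finset (Fin n)) :
    boundaryMatrix n s t ≠ 0 ↔ s ⊆ t ∧ t.card = s.card + 1 := by
  induction n with
  | zero => simp [boundaryMatrix, Subsingleton.elim s t]
  | succ n ih =>
    obtain ⟨x, rfl⟩ := (faceEquiv n).surjective s
    obtain ⟨y, rfl⟩ := (faceEquiv n).surjective t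
    rw [boundaryMatrix, Matrix.submatrix_apply, Equiv.symm_apply_apply, Equiv.symm_apply_apply]
    simp only [faceEquiv, Equiv.ofBijective_apply]
    rcases x with s | s <;> rcases y with t | t
    · simp [extendFace, ih]
    · have h0 : (0 : Fin (n + 1)) ∉ s.map (Fin.succEmb n) := by simp
      simp only [extendFace, Matrix.fromBlocks_apply₁₂, Matrix.one_apply, Finset.cons_eq_insert,
        Finset.subset_insert_iff_of_notMem h0, Finset.map_subset_map]
      rw [Finset.card_insert_of_notMem (by simp), Finset.card_map, Finset.card_map]
      constructor
      · intro h
        have : s = t := by by_contra hst; simp [hst] at h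
        subst this
        simp
      · rintro ⟨hst, hc⟩
        simp [Finset.eq_of_subset_of_card_le hst (by omega)]
    · simp [extendFace, Finset.cons_eq_insert, Finset.insert_subset_iff]
    · simp [extendFace, ih]

theorem det_one_add_boundaryMatrix (n : ℕ) (hn : 1 ≤ n) :
    (boundaryMatrix n * (boundaryMatrix n)ᵀ + 1).det = ((n : ℤ) + 1) ^ 2 ^ (n - 1) := by
  set E := boundaryMatrix n
  have hEt : Eᵀ * Eᵀ = 0 := by
    rw [← Matrix.transpose_mul, boundaryMatrix_mul_self, Matrix.transpose_zero]
  have hprod : (E * Eᵀ + 1) * (Eᵀ * E + 1) =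
      ((n : ℤ) + 1) • (1 : Matrix (Finset (Fin n)) (Finset (Fin n)) ℤ) := by
    have : E * Eᵀ * (Eᵀ * E) = 0 := by
      rw [Matrix.mul_assoc, ← Matrix.mul_assoc Eᵀ, hEt]; simp
    rw [add_mul, mul_add, this, add_smul, ← boundaryMatrix_laplacian]
    simp only [mul_one, one_mul, one_smul, zero_add, add_assoc, E]
  have hsq : (E * Eᵀ + 1).det ^ 2 = (((n : ℤ) + 1) ^ 2 ^ (n - 1)) ^ 2 := by
    have := congrArg Matrix.det hprod
    rw [Matrix.det_mul, Matrix.det_mul_add_one_comm Eᵀ E, ← sq, Matrix.det_smul,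
      Matrix.det_one, mul_one] at this
    rw [this, ← pow_mul, ← pow_succ, Nat.sub_add_cancel hn]
    simp
  have hnonneg : 0 ≤ (E * Eᵀ + 1).det := by
    have := det_mul_transpose_nonneg
      (Matrix.fromCols E (1 : Matrix (Finset (Fin n)) (Finset (Fin n)) ℤ))
    rwa [Matrix.transpose_fromCols, Matrix.fromCols_mul_fromRows, Matrix.transpose_one,
      mul_one] at this
  exact (sq_eq_sq₀ hnonneg (by positivity)).1 hsq

/-- The rows of faces avoiding `0` span the row space of the boundary matrix. -/
theorem boundaryMatrix_succ_factor (n : ℕ) :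
    boundaryMatrix (n + 1) =
      (Matrix.fromRows 1 (-boundaryMatrix n)).submatrix (faceEquiv n).symm id *
        (Matrix.fromCols (boundaryMatrix n) 1).submatrix id (faceEquiv n).symm := by
  rw [← Matrix.submatrix_mul _ _ _ _ _ Function.bijective_id, Matrix.fromRows_mul_fromCols,
    boundaryMatrix]
  simp [boundaryMatrix_mul_self]

/-! ### Perfect Morse matchings -/

section Matching

variable {n : ℕ} {V : Type} [DecidableEq V] {K : Finset (Finset V)}

/-- Acyclicity makes a Morse matching the unique matching on its set of matched faces. -/
theorem perm_eq_one_of_isMorseMatching {M : Set (Finset V × Finset V)} (hM : IsMorseMatching K M)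
    {β : Type*} [Finite β] {a b : β → Finset V} (hab : ∀ i, (b i, a i) ∈ M)
    (hb : Function.Injective b) (π : Equiv.Perm β) (hπ : ∀ i, HasseArc K (b i) (a (π i))) :
    π = 1 := by
  obtain ⟨harc, hmatch, hacyc⟩ := hM
  by_contra hne
  obtain ⟨i, hi⟩ : ∃ i, π i ≠ i := by
    by_contra! h
    exact hne (Equiv.ext h)
  have step (j : β) (hj : π j ≠ j) :
      Relation.TransGen (MorseStep K M) (b j) (b (π j)) := by
    refine .tail (.single (Or.inl ⟨hπ j, fun hmem => ?_⟩)) (Or.inr ⟨hab _, harc _ (hab _)⟩)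
    have hbne : b j ≠ b (π j) := fun h => hj (hb h).symm
    exact (hmatch _ hmem _ (hab (π j)) fun h => hbne (congrArg Prod.fst h)).2.2.2 rfl
  have iter (k : ℕ) : Relation.TransGen (MorseStep K M) (b i) (b ((π ^ (k + 1)) i)) := by
    induction k with
    | zero => simpa using step i hi
    | succ k ih =>
      refine ih.trans ?_
      rw [pow_succ' π (k + 1), Equiv.Perm.mul_apply]
      refine step _ fun h => hi ?_
      rw [← Equiv.Perm.mul_apply, ← pow_succ', pow_succ, Equiv.Perm.mul_apply] at h
      exact (π ^ (k + 1)).injective h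
  have hpos : 0 < orderOf π := orderOf_pos π
  have := iter (orderOf π - 1)
  rw [Nat.sub_add_cancel hpos, pow_orderOf_eq_one] at this
  exact hacyc _ this

theorem IsMorseMatching.fst_injOn {M : Set (Finset V × Finset V)} (hM : IsMorseMatching K M) :
    Set.InjOn Prod.fst M := fun p hp q hq h => by
  by_contra hne
  exact (hM.2.1 p hp q hq hne).1 h

theorem IsMorseMatching.snd_injOn {M : Set (Finset V × Finset V)} (hM : IsMorseMatching K M) :
    Set.InjOn Prod.snd M := fun p hp q hq h => by
  by_contra hne
  exact (hM.2.1 p hp q hq hne).2.2.2 h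

theorem IsMorseMatching.fst_ne_snd {M : Set (Finset V × Finset V)} (hM : IsMorseMatching K M)
    {p q : Finset V × Finset V} (hp : p ∈ M) (hq : q ∈ M) : p.1 ≠ q.2 := by
  by_cases hpq : p = q
  · subst hpq
    exact (hM.1 p hp).2.2.1.ne'
  · exact (hM.2.1 p hp q hq hpq).2.1

theorem image_snd_eq_compl {M : Finset (Finset (Fin n) × Finset (Fin n))}
    (hM : IsPerfectMorseMatching (fullSimplex n) ↑M) :
    M.image Prod.snd = (M.image Prod.fst)ᶜ := by
  ext s
  simp only [Finset.mem_image, Finset.mem_compl]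
  constructor
  · rintro ⟨p, hp, rfl⟩ ⟨q, hq, h⟩
    exact IsMorseMatching.fst_ne_snd hM.1 hq hp h
  · intro h
    obtain ⟨p, hp, hs | hs⟩ := hM.2 s (by simp [fullSimplex])
    · exact absurd ⟨p, hp, hs⟩ h
    · exact ⟨p, hp, hs⟩

theorem card_eq_two_pow {M : Finset (Finset (Fin (n + 1)) × Finset (Fin (n + 1)))}
    (hM : IsPerfectMorseMatching (fullSimplex (n + 1)) ↑M) : M.card = 2 ^ n := by
  have h := congrArg Finset.card (image_snd_eq_compl hM)
  rw [Finset.card_compl, Finset.card_image_of_injOn (IsMorseMatching.snd_injOn hM.1),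
    Finset.card_image_of_injOn (IsMorseMatching.fst_injOn hM.1)] at h
  simp only [Fintype.card_finset, Fintype.card_fin, pow_succ] at h
  have := Nat.pos_of_ne_zero (pow_ne_zero n (two_ne_zero (α := ℕ)))
  omega

/-- A perfect Morse matching is determined by the set of faces matched downwards. -/
theorem eq_of_image_fst_eq {M M' : Finset (Finset (Fin n) × Finset (Fin n))}
    (hM : IsPerfectMorseMatching (fullSimplex n) ↑M)
    (hM' : IsPerfectMorseMatching (fullSimplex n) ↑M')
    (h : M.image Prod.fst = M'.image Prod.fst) : M' = M := by
  have h₂ : M.image Prod.snd = M'.image Prod.snd := by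
    rw [image_snd_eq_compl hM, image_snd_eq_compl hM', h]
  have hfst (p : M') : ∃ q : M, q.1.1 = p.1.1 := by
    obtain ⟨q, hq, hqp⟩ := Finset.mem_image.1 (h ▸ Finset.mem_image_of_mem Prod.fst p.2)
    exact ⟨⟨q, hq⟩, hqp⟩
  have hsnd (p : M') : ∃ q : M, q.1.2 = p.1.2 := by
    obtain ⟨q, hq, hqp⟩ := Finset.mem_image.1 (h₂ ▸ Finset.mem_image_of_mem Prod.snd p.2)
    exact ⟨⟨q, hq⟩, hqp⟩
  choose u hu using hfst
  choose w hw using hsnd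
  have hcard : Fintype.card M' = Fintype.card M := by
    rw [Fintype.card_coe, Fintype.card_coe,
      ← Finset.card_image_of_injOn (IsMorseMatching.fst_injOn hM.1),
      ← Finset.card_image_of_injOn (IsMorseMatching.fst_injOn hM'.1), h]
  have hubij : Function.Bijective u := by
    rw [Fintype.bijective_iff_injective_and_card]
    refine ⟨fun p q hpq => Subtype.ext (IsMorseMatching.fst_injOn hM'.1 p.2 q.2 ?_), hcard⟩
    rw [← hu p, ← hu q, hpq]
  have hwbij : Function.Bijective w := by
    rw [Fintype.bijective_iff_injective_and_card]
    refine ⟨fun p q hpq => Subtype.ext (IsMorseMatching.snd_injOn hM'.1 p.2 q.2 ?_), hcard⟩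
    rw [← hw p, ← hw q, hpq]
  let eu := Equiv.ofBijective u hubij
  let ew := Equiv.ofBijective w hwbij
  have hπ := perm_eq_one_of_isMorseMatching hM.1 (β := M) (a := fun q => q.1.2)
    (b := fun q => q.1.1) (fun q => q.2)
    (fun p q hpq => Subtype.ext (IsMorseMatching.fst_injOn hM.1 p.2 q.2 hpq))
    (eu.symm.trans ew) (fun q => by
      obtain ⟨p, rfl⟩ := eu.surjective q
      rw [Equiv.trans_apply, Equiv.symm_apply_apply]
      change HasseArc _ (u p).1.1 (w p).1.2
      rw [hu, hw]
      exact hM'.1.1 _ p.2)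
  have huw (p : M') : w p = u p := by
    have := Equiv.congr_fun hπ (eu p)
    rwa [Equiv.trans_apply, Equiv.symm_apply_apply] at this
  refine Finset.eq_of_subset_of_card_le (fun p hp => ?_) ?_
  · have : (u ⟨p, hp⟩).1 = p := Prod.ext (hu ⟨p, hp⟩) (by rw [← huw]; exact hw ⟨p, hp⟩)
    exact this ▸ (u ⟨p, hp⟩).2
  · simpa using hcard.ge

/-- The set of faces matched downwards by a perfect Morse matching indexes a nonsingular
maximal minor of the reduced boundary matrix. -/
theorem exists_det_ne_zero {M : Finset (Finset (Fin (n + 1)) × Finset (Fin (n + 1)))}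
    (hM : IsPerfectMorseMatching (fullSimplex (n + 1)) ↑M) :
    ∃ b : Finset (Fin n) → Finset (Fin (n + 1)), Function.Injective b ∧
      Finset.univ.image b = M.image Prod.fst ∧
      (((Matrix.fromCols (boundaryMatrix n) 1).submatrix id (faceEquiv n).symm).submatrix
        id b).det ≠ 0 := by
  obtain ⟨e⟩ : Nonempty (Finset (Fin n) ≃ M) :=
    ⟨Fintype.equivOfCardEq (by simp [card_eq_two_pow hM])⟩
  have hb : Function.Injective fun i => (e i).1.1 := fun i j hij =>
    e.injective (Subtype.ext (IsMorseMatching.fst_injOn hM.1 (e i).2 (e j).2 hij))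
  refine ⟨fun i => (e i).1.1, hb, ?_, ?_⟩
  · ext s
    simp only [Finset.mem_image, Finset.mem_univ, true_and]
    constructor
    · rintro ⟨i, rfl⟩
      exact ⟨_, (e i).2, rfl⟩
    · rintro ⟨p, hp, rfl⟩
      exact ⟨e.symm ⟨p, hp⟩, by simp⟩
  · have hdet : ((boundaryMatrix (n + 1)).submatrix (fun i => (e i).1.2)
        (fun i => (e i).1.1)).det ≠ 0 := by
      rw [Matrix.det_apply', Finset.sum_eq_single 1]
      · simp only [Equiv.Perm.sign_one, Units.val_one, Int.cast_one, one_mul,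
          Equiv.Perm.one_apply, Matrix.submatrix_apply]
        refine Finset.prod_ne_zero_iff.2 fun i _ => (boundaryMatrix_ne_zero_iff _ _ _).2 ?_
        have := hM.1.1 _ (e i).2
        exact ⟨this.2.2.1.subset, this.2.2.2⟩
      · intro σ _ hσ
        by_contra hne
        refine hσ (perm_eq_one_of_isMorseMatching hM.1 (fun i => (e i).2) hb σ fun i => ?_)
        have hi := Finset.prod_ne_zero_iff.1 (right_ne_zero_of_mul hne) i (Finset.mem_univ i)
        obtain ⟨hsub, hcard⟩ := (boundaryMatrix_ne_zero_iff _ _ _).1 hi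
        refine ⟨by simp [fullSimplex], by simp [fullSimplex], ?_, hcard⟩
        exact Finset.ssubset_iff_subset_ne.2 ⟨hsub, fun h =>
          Nat.succ_ne_self _ (hcard.symm.trans (congrArg Finset.card h.symm))⟩
      · simp
    rw [boundaryMatrix_succ_factor, Matrix.submatrix_mul _ _ _ id _ Function.bijective_id,
      Matrix.det_mul] at hdet
    exact right_ne_zero_of_mul hdet

theorem card_finset_perfectMorseMatching_le (hn : 1 ≤ n)
    (S : Finset (Finset (Finset (Fin (n + 1)) × Finset (Fin (n + 1)))))
    (hS : ∀ M ∈ S, IsPerfectMorseMatching (fullSimplex (n + 1)) ↑M) :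
    (S.card : ℤ) ≤ ((n : ℤ) + 1) ^ 2 ^ (n - 1) := by
  have hle := card_le_det_mul_transpose
    ((Matrix.fromCols (boundaryMatrix n) 1).submatrix id (faceEquiv n).symm)
    (S.image fun M => M.image Prod.fst) fun B hB => by
      obtain ⟨M, hM, rfl⟩ := Finset.mem_image.1 hB
      exact exists_det_ne_zero (hS M hM)
  rwa [Finset.card_image_of_injOn fun M hM M' hM' h =>
      (eq_of_image_fst_eq (hS M hM) (hS M' hM') h).symm,
    Matrix.transpose_submatrix, Matrix.submatrix_mul_equiv, Matrix.transpose_fromCols,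
    Matrix.fromCols_mul_fromRows, Matrix.transpose_one, mul_one, Matrix.submatrix_id_id,
    det_one_add_boundaryMatrix n hn] at hle

end Matching

end PerfectMorse

open PerfectMorse

/-- the number `f(n)` of perfect Morse matchings of the `n`-dimensional
simplex `Δ_n` satisfies `f(n) ≤ (n+1)^(2^(n-1))`, for every `n ≥ 1`. -/
theorem card_perfect_morse_matchings_simplex_le (n : ℕ) (hn : 1 ≤ n) :
    {M : Finset (Finset (Fin (n + 1)) × Finset (Fin (n + 1))) |
        IsPerfectMorseMatching (fullSimplex (n + 1)) ↑M}.ncard ≤ (n + 1) ^ 2 ^ (n - 1) := by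
  set S := {M : Finset (Finset (Fin (n + 1)) × Finset (Fin (n + 1))) |
    IsPerfectMorseMatching (fullSimplex (n + 1)) ↑M}
  have hfin : S.Finite := Set.toFinite S
  rw [Set.ncard_eq_toFinset_card S hfin]
  exact_mod_cast card_finset_perfectMorseMatching_le hn hfin.toFinset fun M hM =>
    hfin.mem_toFinset.1 hM
end

section
/- Define r(1)=1, r(2)=2, r(3)=9 and r(n+1) = ((n+1)(n−1)/n)·r(n)^2 for n ≥ 3. Then for every n ≥ 3, the number f(n) of perfect Morse matchings of the n-dimensional simplex Δ_n satisfies f(n) ≥ r(n+1). -/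
open Finset

/-- The sequence `r` of rationals: `r 1 = 1`, `r 2 = 2`, `r 3 = 9` and
`r (n+1) = ((n+1)(n-1)/n) * r n ^ 2` for `n ≥ 3`. -/
def r : ℕ → ℚ
  | 0 => 1
  | 1 => 1
  | 2 => 2
  | 3 => 9
  | (n + 4) => (((n : ℚ) + 4) * ((n : ℚ) + 2) / ((n : ℚ) + 3)) * r (n + 3) ^ 2

namespace MorseCube

/-- The face of the simplex on `Fin n` given by its indicator function, with the vertex `i`
added or removed. -/
def toggle {n : ℕ} (x : Fin n → Bool) (i : Fin n) : Fin n → Bool :=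
  Function.update x i (!x i)

/-- A step in the Hasse diagram of the Boolean lattice, after reversal of the arcs which join
`x` to `toggle x (d x)`. -/
def Step {n : ℕ} (d : (Fin n → Bool) → Fin n) (x y : Fin n → Bool) : Prop :=
  ∃ i, y = toggle x i ∧ (x i = true ↔ d x ≠ i)

/-- The direction function `d` encodes a perfect Morse matching of the Boolean lattice, in which
`x` is matched to `toggle x (d x)`. -/
def IsPerfect {n : ℕ} (d : (Fin n → Bool) → Fin n) : Prop :=
  (∀ x, d (toggle x (d x)) = d x) ∧ ∀ x, ¬ Relation.TransGen (Step d) x x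

/-- The direction function on the `(n+1)`-cube which agrees with `D b` on the facet where the
coordinate `v` equals `b`. -/
def glue {n : ℕ} (v : Fin (n + 1)) (D : Bool → (Fin n → Bool) → Fin n)
    (z : Fin (n + 1) → Bool) : Fin (n + 1) :=
  v.succAbove (D (z v) (v.removeNth z))

theorem glue_insertNth {n : ℕ} (v : Fin (n + 1)) (D : Bool → (Fin n → Bool) → Fin n)
    (b : Bool) (x : Fin n → Bool) :
    glue v D (v.insertNth b x) = v.succAbove (D b x) := by
  simp [glue]

theorem toggle_insertNth_succAbove {n : ℕ} (v : Fin (n + 1)) (b : Bool) (x : Fin n → Bool)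
    (i : Fin n) :
    toggle (v.insertNth b x : Fin (n + 1) → Bool) (v.succAbove i)
      = (v.insertNth b (toggle x i) : Fin (n + 1) → Bool) := by
  simp [toggle]

theorem toggle_insertNth_self {n : ℕ} (v : Fin (n + 1)) (b : Bool) (x : Fin n → Bool) :
    toggle (v.insertNth b x : Fin (n + 1) → Bool) v
      = (v.insertNth (!b) x : Fin (n + 1) → Bool) := by
  simp [toggle]

theorem exists_eq_insertNth {n : ℕ} (v : Fin (n + 1)) (z : Fin (n + 1) → Bool) :
    ∃ (b : Bool) (x : Fin n → Bool), z = v.insertNth b x :=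
  ⟨z v, v.removeNth z, by simp⟩

theorem step_glue {n : ℕ} {v : Fin (n + 1)} {D : Bool → (Fin n → Bool) → Fin n}
    {b : Bool} {x y : Fin n → Bool} (h : Step (D b) x y) :
    Step (glue v D) (v.insertNth b x) (v.insertNth b y) := by
  obtain ⟨i, rfl, hi⟩ := h
  exact ⟨v.succAbove i, (toggle_insertNth_succAbove v b x i).symm, by
    simpa [glue_insertNth] using hi⟩

theorem le_and_step_of_step_glue {n : ℕ} {v : Fin (n + 1)}
    {D : Bool → (Fin n → Bool) → Fin n} {z z' : Fin (n + 1) → Bool} (h : Step (glue v D) z z') :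
    z' v ≤ z v ∧ (z' v = z v → Step (D (z v)) (v.removeNth z) (v.removeNth z')) := by
  obtain ⟨i, rfl, hi⟩ := h
  obtain ⟨b, x, rfl⟩ := exists_eq_insertNth v z
  rcases Fin.eq_self_or_eq_succAbove v i with rfl | ⟨j, rfl⟩
  · have hb : b = true := by simpa [glue_insertNth] using hi
    subst hb
    simp [toggle_insertNth_self]
  · refine ⟨by simp [toggle_insertNth_succAbove], fun _ => ⟨j, ?_, ?_⟩⟩
    · simp [toggle_insertNth_succAbove]
    · simpa [glue_insertNth] using hi

theorem le_and_transGen_of_transGen_glue {n : ℕ} {v : Fin (n + 1)}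
    {D : Bool → (Fin n → Bool) → Fin n} {z z' : Fin (n + 1) → Bool}
    (h : Relation.TransGen (Step (glue v D)) z z') :
    z' v ≤ z v ∧
      (z' v = z v → Relation.TransGen (Step (D (z v))) (v.removeNth z) (v.removeNth z')) := by
  induction h with
  | single h =>
    exact ⟨(le_and_step_of_step_glue h).1, fun e => .single ((le_and_step_of_step_glue h).2 e)⟩
  | @tail y w _ h ih =>
    obtain ⟨h₁, h₂⟩ := le_and_step_of_step_glue h
    refine ⟨h₁.trans ih.1, fun e => ?_⟩
    have hy : y v = z v := le_antisymm ih.1 (e ▸ h₁)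
    exact (ih.2 hy).tail (hy ▸ h₂ (e.trans hy.symm))

theorem isPerfect_glue {n : ℕ} (v : Fin (n + 1)) (D : Bool → (Fin n → Bool) → Fin n) :
    IsPerfect (glue v D) ↔ ∀ b, IsPerfect (D b) := by
  constructor
  · intro h b
    refine ⟨fun x => ?_, fun x hx => h.2 (v.insertNth b x) ?_⟩
    · simpa [glue_insertNth, toggle_insertNth_succAbove] using h.1 (v.insertNth b x)
    · exact hx.lift (fun x => (v.insertNth b x : Fin (n + 1) → Bool)) fun _ _ => step_glue
  · intro h
    refine ⟨fun z => ?_, fun z hz => (h (z v)).2 _ ((le_and_transGen_of_transGen_glue hz).2 rfl)⟩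
    obtain ⟨b, x, rfl⟩ := exists_eq_insertNth v z
    simp [glue_insertNth, toggle_insertNth_succAbove, (h b).1 x]

theorem glue_injective {n : ℕ} (v : Fin (n + 1)) :
    Function.Injective (glue v : (Bool → (Fin n → Bool) → Fin n) → _) := by
  intro D D' h
  funext b x
  simpa [glue_insertNth] using congrFun h (v.insertNth b x)

theorem exists_glue_eq {n : ℕ} {v : Fin (n + 1)} {d : (Fin (n + 1) → Bool) → Fin (n + 1)}
    (h : ∀ z, d z ≠ v) : ∃ D, glue v D = d := by
  choose e he using fun z => Fin.exists_succAbove_eq (h z)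
  refine ⟨fun b x => e (v.insertNth b x), funext fun z => ?_⟩
  simp [glue, he]

/-- The direction functions avoiding the direction `v` are the pairs of direction functions on
the two facets orthogonal to `v`. -/
theorem card_filter_avoiding {n : ℕ} (v : Fin (n + 1)) (P : ((Fin n → Bool) → Fin n) → Prop)
    (Q : ((Fin (n + 1) → Bool) → Fin (n + 1)) → Prop) [DecidablePred P]
    [DecidablePred fun d => Q d ∧ ∀ z, d z ≠ v]
    (h : ∀ D, Q (glue v D) ↔ ∀ b, P (D b)) :
    #{d | Q d ∧ ∀ z, d z ≠ v} = #{d | P d} ^ 2 := by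
  have himage : ({d | Q d ∧ ∀ z, d z ≠ v} : Finset _)
      = (Fintype.piFinset fun _ : Bool => ({d | P d} : Finset _)).image (glue v) := by
    ext d
    simp only [mem_filter, mem_univ, true_and, mem_image, Fintype.mem_piFinset]
    constructor
    · rintro ⟨hQ, hv⟩
      obtain ⟨D, rfl⟩ := exists_glue_eq hv
      exact ⟨D, (h D).1 hQ, rfl⟩
    · rintro ⟨D, hD, rfl⟩
      exact ⟨(h D).2 hD, fun z => Fin.succAbove_ne _ _⟩
  rw [himage, card_image_of_injective _ (glue_injective v), Fintype.card_piFinset]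
  simp [sq]

open Classical in
/-- The number of perfect Morse matchings of the Boolean lattice of rank `n`. -/
noncomputable def count (n : ℕ) : ℕ := #{d : (Fin n → Bool) → Fin n | IsPerfect d}

open Classical in
theorem card_avoiding (n : ℕ) (v : Fin (n + 1)) :
    #{d | IsPerfect d ∧ ∀ z, d z ≠ v} = count n ^ 2 :=
  card_filter_avoiding v _ _ (isPerfect_glue v)

open Classical in
theorem card_avoiding_avoiding (n : ℕ) (v w : Fin (n + 2)) (hvw : w ≠ v) :
    #{d | IsPerfect d ∧ (∀ z, d z ≠ v) ∧ ∀ z, d z ≠ w} = count n ^ 4 := by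
  obtain ⟨w, rfl⟩ := Fin.exists_succAbove_eq hvw
  have h := card_filter_avoiding v (fun d => IsPerfect d ∧ ∀ x, d x ≠ w)
    (fun d => IsPerfect d ∧ ∀ z, d z ≠ v.succAbove w) (fun D => by
      rw [isPerfect_glue, forall_and]
      refine and_congr_right fun _ => ⟨fun h b x hx => ?_, fun h z hz => ?_⟩
      · exact h (v.insertNth b x) (by rw [glue_insertNth, hx])
      · exact h _ _ (Fin.succAbove_right_injective hz))
  rw [card_avoiding, ← pow_mul] at h
  rw [← h]
  congr 1
  ext d
  simp only [mem_filter, mem_univ, true_and]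
  tauto

theorem isPerfect_const {n : ℕ} (w : Fin n) : IsPerfect fun _ : Fin n → Bool => w := by
  refine ⟨fun _ => rfl, fun x hx => ?_⟩
  have hlt : ∀ a b : Fin n → Bool, Step (fun _ => w) a b → toggle b w < toggle a w := by
    rintro a _ ⟨i, rfl, hi⟩
    by_cases hiw : w = i
    · subst hiw
      have ha : a w = false := by simpa using hi
      simp [toggle, ha]
    · have ha : a i = true := by simpa [hiw] using hi
      simp only [toggle, ha, Function.update_of_ne hiw, Bool.not_true]
      rw [Function.update_comm (Ne.symm hiw), update_lt_self_iff]
      simp [ha, Ne.symm hiw]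
  have : ∀ a b : Fin n → Bool, Relation.TransGen (Step fun _ => w) a b →
      toggle b w < toggle a w := fun a b h => by
    induction h with
    | single h => exact hlt _ _ h
    | tail _ h ih => exact (hlt _ _ h).trans ih
  exact lt_irrefl _ (this x x hx)

theorem count_zero : count 0 = 0 := by
  classical
  rw [count, card_eq_zero, filter_eq_empty_iff]
  exact fun d => (d Fin.elim0).elim0

theorem count_one : count 1 = 1 := by
  classical
  rw [count, filter_true_of_mem]
  · simp
  · intro d _
    rw [Subsingleton.elim d fun _ => 0]
    exact isPerfect_const 0

theorem count_two_le : count 2 ≤ 2 := by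
  have key : ∀ d : (Fin 2 → Bool) → Fin 2, (∀ x, d (toggle x (d x)) = d x) →
      ∀ x, d x = d fun _ => false := by
    intro d hd
    have htoggle : ∀ x i, d (toggle x i) = d x := by
      intro x i
      by_cases hx : d x = i
      · exact hx ▸ hd x
      · have hy : d (toggle x i) ≠ i := fun hy => hx (by
          have := hd (toggle x i)
          rw [hy] at this
          simpa [toggle] using this)
        omega
    have hset : ∀ x i, d (Function.update x i false) = d x := by
      intro x i
      cases hi : x i
      · rw [← hi, Function.update_eq_self]
      · simpa [toggle, hi] using htoggle x i
    intro x
    rw [← hset x 0, ← hset _ 1]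
    congr 1
    funext i
    fin_cases i <;> simp
  classical
  have hinj : Set.InjOn (fun d : (Fin 2 → Bool) → Fin 2 => d fun _ => false)
      ({d | IsPerfect d} : Finset ((Fin 2 → Bool) → Fin 2)) := by
    intro d hd e he h
    funext x
    rw [key d (mem_filter.1 hd).2.1, key e (mem_filter.1 he).2.1]
    exact h
  simpa [count] using card_le_card_of_injOn (t := univ) _ (fun _ _ => mem_univ _) hinj

open Classical in
/-- The second Bonferroni inequality for the events that a given direction is unused, sharpened by
the contribution of the matchings using one direction only. -/
theorem count_recursion (n : ℕ) :
    2 * ((n : ℤ) + 2) * count (n + 1) ^ 2 + (n + 2) * n * (n - 1)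
      ≤ 2 * count (n + 2) + (n + 2) * (n + 1) * count n ^ 4 := by
  set G : Finset ((Fin (n + 2) → Bool) → Fin (n + 2)) := {d | IsPerfect d} with hG
  set m : ((Fin (n + 2) → Bool) → Fin (n + 2)) → ℤ :=
    fun d => ∑ v, if ∀ z, d z ≠ v then 1 else 0 with hm
  have hsum : ∑ d ∈ G, m d = (n + 2) * count (n + 1) ^ 2 := by
    rw [hm, sum_comm]
    simp_rw [sum_boole, hG, filter_filter, card_avoiding]
    simp
  have hsq : ∑ d ∈ G, m d ^ 2
      = (n + 2) * count (n + 1) ^ 2 + (n + 2) * (n + 1) * count n ^ 4 := by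
    have hpair : ∀ v w : Fin (n + 2),
        ∑ d ∈ G, ((if ∀ z, d z ≠ v then (1 : ℤ) else 0) * if ∀ z, d z ≠ w then 1 else 0)
          = if w = v then (count (n + 1) : ℤ) ^ 2 else count n ^ 4 := by
      intro v w
      simp_rw [mul_ite, mul_one, mul_zero, ← ite_and, sum_boole, hG, filter_filter]
      split_ifs with h
      · subst h
        simp_rw [and_self, card_avoiding]
        simp
      · rw [card_avoiding_avoiding n w v (Ne.symm h)]
        simp
    simp_rw [hm, sq, sum_mul_sum]
    rw [sum_comm]
    simp_rw [sum_comm (s := G), hpair, sum_ite, sum_const, filter_ne', filter_eq']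
    simp
    ring
  have hconst : ∀ w : Fin (n + 2), m (fun _ => w) = n + 1 := by
    intro w
    simp [hm, filter_ne]
  have hnonneg : ∀ d, 0 ≤ (m d - 1) * (m d - 2) := by
    intro d
    rcases le_or_gt (m d) 1 with h | h <;> nlinarith
  have hle : ∑ w : Fin (n + 2), (m (fun _ => w) - 1) * (m (fun _ => w) - 2)
      ≤ ∑ d ∈ G, (m d - 1) * (m d - 2) := by
    have hinj : Function.Injective fun (w : Fin (n + 2)) (_ : Fin (n + 2) → Bool) => w :=
      fun a b h => congrFun h fun _ => false
    rw [← sum_image (f := fun d => (m d - 1) * (m d - 2)) hinj.injOn]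
    refine sum_le_sum_of_subset_of_nonneg ?_ fun d _ _ => hnonneg d
    intro d hd
    obtain ⟨w, -, rfl⟩ := mem_image.1 hd
    exact mem_filter.2 ⟨mem_univ _, isPerfect_const w⟩
  have hcard : ∑ d ∈ G, (m d - 1) * (m d - 2)
      = ∑ d ∈ G, m d ^ 2 - 3 * ∑ d ∈ G, m d + 2 * count (n + 2) := by
    have : (count (n + 2) : ℤ) = ∑ d ∈ G, 1 := by simp [count, hG]
    rw [this, mul_sum, mul_sum, ← sum_sub_distrib, ← sum_add_distrib]
    exact sum_congr rfl fun d _ => by ring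
  rw [hcard, hsum, hsq] at hle
  simp only [hconst, sum_const, card_univ, Fintype.card_fin, nsmul_eq_mul] at hle
  push_cast at hle
  linarith

theorem count_two : count 2 = 2 := by
  have h := count_recursion 0
  have h' := count_two_le
  simp [count_zero, count_one] at h
  omega

theorem nine_le_count_three : 9 ≤ count 3 := by
  have h := count_recursion 1
  simp [count_two, count_one] at h
  omega

theorem count_succ_ge (n : ℕ) (h : (n + 2) ^ 2 * count (n + 1) ^ 4 ≤ 2 * count (n + 2) ^ 2) :
    ((n : ℚ) + 3) * (n + 1) / (n + 2) * count (n + 2) ^ 2 ≤ count (n + 3) := by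
  have hrec : (2 * ((n : ℚ) + 3)) * count (n + 2) ^ 2 + (n + 3) * (n + 1) * n
      ≤ 2 * count (n + 3) + (n + 3) * (n + 2) * count (n + 1) ^ 4 := by
    have := count_recursion (n + 1)
    have hcast : ((n : ℤ) + 1 + 2) = n + 3 := by ring
    push_cast at this
    rw [hcast] at this
    have : (2 * ((n : ℤ) + 3)) * count (n + 2) ^ 2 + (n + 3) * (n + 1) * n
      ≤ 2 * count (n + 3) + (n + 3) * (n + 2) * count (n + 1) ^ 4 := by linarith
    exact_mod_cast this
  have hq : ((n : ℚ) + 2) ^ 2 * count (n + 1) ^ 4 ≤ 2 * count (n + 2) ^ 2 := by exact_mod_cast h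
  rw [div_mul_eq_mul_div, div_le_iff₀ (by positivity)]
  have h₁ := mul_le_mul_of_nonneg_left hq (by positivity : (0 : ℚ) ≤ n + 3)
  have h₂ := mul_le_mul_of_nonneg_left hrec (by positivity : (0 : ℚ) ≤ n + 2)
  have h₃ : (0 : ℚ) ≤ (n + 2) * ((n + 3) * (n + 1) * n) := by positivity
  linarith

theorem sq_mul_count_pow_four_le (n : ℕ) :
    (n + 3) ^ 2 * count (n + 2) ^ 4 ≤ 2 * count (n + 3) ^ 2 := by
  induction n with
  | zero =>
    have h := nine_le_count_three
    simp only [zero_add, count_two]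
    nlinarith
  | succ n ih =>
    rcases n with _ | n
    · have h := count_recursion 2
      have h₃ : (9 : ℤ) ≤ count 3 := by exact_mod_cast nine_le_count_three
      simp only [count_two] at h
      push_cast at h
      have h₄ : (0 : ℤ) ≤ 4 * count 3 ^ 2 - 92 := by nlinarith
      have h₅ : (4 * (count 3 : ℤ) ^ 2 - 92) ^ 2 ≤ (count 4 : ℤ) ^ 2 :=
        pow_le_pow_left₀ h₄ (by linarith) 2
      have h₆ : (81 : ℤ) ≤ (count 3 : ℤ) ^ 2 := by nlinarith
      have : (4 : ℤ) ^ 2 * count 3 ^ 4 ≤ 2 * count 4 ^ 2 := by nlinarith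
      exact_mod_cast this
    · have h := count_succ_ge (n + 2) (by simpa [add_assoc] using ih)
      have hsq := pow_le_pow_left₀ (by positivity) h 2
      have hcoef : ((n : ℚ) + 5) ^ 2 ≤ 2 * ((n + 5) * (n + 3) / (n + 4)) ^ 2 := by
        rw [div_pow, mul_div_assoc', le_div_iff₀ (by positivity), mul_pow]
        have : ((n : ℚ) + 4) ^ 2 ≤ 2 * (n + 3) ^ 2 := by
          have : (0 : ℚ) ≤ n := by positivity
          nlinarith
        nlinarith [sq_nonneg ((n : ℚ) + 5)]
      have : ((n : ℚ) + 5) ^ 2 * (count (n + 4) : ℚ) ^ 4 ≤ 2 * (count (n + 5) : ℚ) ^ 2 := by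
        calc ((n : ℚ) + 5) ^ 2 * (count (n + 4) : ℚ) ^ 4
            ≤ 2 * ((n + 5) * (n + 3) / (n + 4)) ^ 2 * (count (n + 4) : ℚ) ^ 4 := by gcongr
          _ = 2 * ((((n + 2 : ℕ) : ℚ) + 3) * ((n + 2 : ℕ) + 1) / ((n + 2 : ℕ) + 2)
                * (count (n + 4) : ℚ) ^ 2) ^ 2 := by
            push_cast
            ring
          _ ≤ 2 * (count (n + 5) : ℚ) ^ 2 := by gcongr
      have h' : (n + 5) ^ 2 * count (n + 4) ^ 4 ≤ 2 * count (n + 5) ^ 2 := by exact_mod_cast this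
      simpa [add_assoc] using h'

theorem r_le_count (n : ℕ) : r (n + 3) ≤ count (n + 3) := by
  induction n with
  | zero =>
    have : (9 : ℚ) ≤ count 3 := by exact_mod_cast nine_le_count_three
    simpa [r] using this
  | succ n ih =>
    have h := count_succ_ge (n + 1) (sq_mul_count_pow_four_le n)
    have hr : 0 ≤ r (n + 3) := by
      cases n with
      | zero => norm_num [r]
      | succ n => rw [r]; positivity
    calc r (n + 1 + 3) = ((n : ℚ) + 4) * (n + 2) / (n + 3) * r (n + 3) ^ 2 := by rw [r]
      _ ≤ ((n : ℚ) + 4) * (n + 2) / (n + 3) * count (n + 3) ^ 2 := by gcongr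
      _ = (((n + 1 : ℕ) : ℚ) + 3) * ((n + 1 : ℕ) + 1) / ((n + 1 : ℕ) + 2) * count (n + 3) ^ 2 := by
        push_cast
        ring
      _ ≤ count (n + 1 + 3) := h

/-- The indicator function of a face. -/
def indicator {n : ℕ} (s : Finset (Fin n)) (i : Fin n) : Bool := decide (i ∈ s)

/-- The set of pairs of faces matched by a direction function. -/
def pairs {n : ℕ} (d : (Fin n → Bool) → Fin n) : Finset (Finset (Fin n) × Finset (Fin n)) :=
  {p | d (indicator p.2) ∉ p.2 ∧ p.1 = insert (d (indicator p.2)) p.2}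

theorem toggle_indicator_of_notMem {n : ℕ} {s : Finset (Fin n)} {i : Fin n} (hi : i ∉ s) :
    toggle (indicator s) i = indicator (insert i s) := by
  funext j
  by_cases h : j = i
  · subst h; simp [toggle, indicator, hi]
  · simp [toggle, indicator, h]

theorem toggle_indicator_of_mem {n : ℕ} {s : Finset (Fin n)} {i : Fin n} (hi : i ∈ s) :
    toggle (indicator s) i = indicator (s.erase i) := by
  funext j
  by_cases h : j = i
  · subst h; simp [toggle, indicator, hi]
  · simp [toggle, indicator, h]

theorem mem_pairs_iff_lower {n : ℕ} {d : (Fin n → Bool) → Fin n} {a b : Finset (Fin n)} :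
    (a, b) ∈ pairs d ↔ d (indicator b) ∉ b ∧ a = insert (d (indicator b)) b := by
  simp [pairs]

theorem mem_pairs_iff_upper {n : ℕ} {d : (Fin n → Bool) → Fin n}
    (hd : ∀ x, d (toggle x (d x)) = d x) {a b : Finset (Fin n)} :
    (a, b) ∈ pairs d ↔ d (indicator a) ∈ a ∧ b = a.erase (d (indicator a)) := by
  rw [mem_pairs_iff_lower]
  constructor
  · rintro ⟨hb, rfl⟩
    have h := hd (indicator b)
    rw [toggle_indicator_of_notMem hb] at h
    simp [h, hb]
  · rintro ⟨ha, rfl⟩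
    have h := hd (indicator a)
    rw [toggle_indicator_of_mem ha] at h
    simp [h, ha]

theorem step_of_morseStep {n : ℕ} {d : (Fin n → Bool) → Fin n}
    (hd : ∀ x, d (toggle x (d x)) = d x) {s t : Finset (Fin n)}
    (h : MorseStep (fullSimplex n) (pairs d : Set _) s t) : Step d (indicator s) (indicator t) := by
  rcases h with ⟨⟨-, -, hts, hcard⟩, hM⟩ | ⟨hM, -⟩
  · obtain ⟨i, hi, rfl⟩ : ∃ i ∈ s, t = s.erase i := by
      obtain ⟨i, hi, rfl⟩ := (covBy_iff_exists_insert.1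
        (covBy_iff_card_sdiff_eq_one.2 ⟨hts.1, by rw [card_sdiff_of_subset hts.1]; omega⟩))
      exact ⟨i, by simp, by simp [hi]⟩
    refine ⟨i, (toggle_indicator_of_mem hi).symm, ?_⟩
    have : d (indicator s) ≠ i := by
      rintro rfl
      exact hM (mem_coe.2 ((mem_pairs_iff_upper hd).2 ⟨hi, rfl⟩))
    simp [indicator, hi, this]
  · obtain ⟨hs, rfl⟩ := mem_pairs_iff_lower.1 (mem_coe.1 hM)
    exact ⟨_, (toggle_indicator_of_notMem hs).symm, by simpa [indicator] using hs⟩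

theorem isPerfectMorseMatching_pairs {n : ℕ} {d : (Fin n → Bool) → Fin n} (hd : IsPerfect d) :
    IsPerfectMorseMatching (fullSimplex n) (pairs d : Set _) := by
  refine ⟨⟨?_, ?_, fun s hs => hd.2 _ (hs.lift indicator fun _ _ => step_of_morseStep hd.1)⟩, ?_⟩
  · rintro ⟨a, b⟩ h
    obtain ⟨hb, rfl⟩ := mem_pairs_iff_lower.1 (mem_coe.1 h)
    exact ⟨by simp [fullSimplex], by simp [fullSimplex], ssubset_insert hb,
      card_insert_of_notMem hb⟩
  · rintro ⟨a, b⟩ hp ⟨a', b'⟩ hq hne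
    obtain ⟨hb, hab⟩ := mem_pairs_iff_lower.1 (mem_coe.1 hp)
    obtain ⟨ha, hba⟩ := (mem_pairs_iff_upper hd.1).1 (mem_coe.1 hp)
    obtain ⟨hb', hab'⟩ := mem_pairs_iff_lower.1 (mem_coe.1 hq)
    obtain ⟨ha', hba'⟩ := (mem_pairs_iff_upper hd.1).1 (mem_coe.1 hq)
    refine ⟨?_, ?_, ?_, ?_⟩ <;> intro h <;> dsimp only at h
    · subst h
      exact hne (by rw [hba, hba'])
    · exact hb' (h ▸ ha)
    · exact hb (h ▸ ha')
    · subst h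
      exact hne (by rw [hab, hab'])
  · intro s _
    by_cases hs : d (indicator s) ∈ s
    · exact ⟨(s, _), mem_coe.2 ((mem_pairs_iff_upper hd.1).2 ⟨hs, rfl⟩), .inl rfl⟩
    · exact ⟨(_, s), mem_coe.2 (mem_pairs_iff_lower.2 ⟨hs, rfl⟩), .inr rfl⟩

theorem pairs_injOn {n : ℕ} :
    Set.InjOn (pairs : ((Fin n → Bool) → Fin n) → _) {d | IsPerfect d} := by
  intro d hd e he h
  funext x
  obtain ⟨s, rfl⟩ : ∃ s, indicator s = x := ⟨({i | x i} : Finset _), by ext; simp [indicator]⟩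
  by_cases hs : d (indicator s) ∈ s
  · have hmem := (mem_pairs_iff_upper hd.1).2 ⟨hs, rfl⟩
    rw [h, mem_pairs_iff_upper he.1] at hmem
    exact (erase_inj s hs).1 hmem.2
  · have hmem := mem_pairs_iff_lower.2 ⟨hs, rfl⟩
    rw [h, mem_pairs_iff_lower] at hmem
    exact (insert_inj hs).1 hmem.2

theorem count_le_ncard (n : ℕ) :
    count n ≤ {M : Finset (Finset (Fin n) × Finset (Fin n)) |
      IsPerfectMorseMatching (fullSimplex n) ↑M}.ncard := by
  classical
  rw [count, ← Set.ncard_coe_finset]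
  refine Set.ncard_le_ncard_of_injOn pairs ?_ (pairs_injOn.mono ?_) (Set.toFinite _)
  · intro d hd
    exact isPerfectMorseMatching_pairs (mem_filter.1 (mem_coe.1 hd)).2
  · intro d hd
    exact (mem_filter.1 (mem_coe.1 hd)).2

end MorseCube

/-- for every `n ≥ 3`, the number `f(n)` of perfect Morse matchings of the
`n`-dimensional simplex `Δ_n` satisfies `f(n) ≥ r(n+1)`. -/
theorem card_perfect_morse_matchings_simplex_ge (n : ℕ) (hn : 3 ≤ n) :
    (({M : Finset (Finset (Fin (n + 1)) × Finset (Fin (n + 1))) |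
        IsPerfectMorseMatching (fullSimplex (n + 1)) ↑M}.ncard : ℚ)) ≥ r (n + 1) := by
  obtain ⟨k, rfl⟩ := Nat.exists_eq_add_of_le' (show 2 ≤ n by omega)
  exact (MorseCube.r_le_count k).trans (by exact_mod_cast MorseCube.count_le_ncard (k + 3))
end

section
/- Define r(1)=1, r(2)=2, r(3)=9 and r(n+1) = ((n+1)(n−1)/n)·r(n)^2 for n ≥ 3. Then for every n ≥ 1, r(n+1) > ∏_{k=1}^{n−1} k^{2^{n−k−1}} (the empty product being 1). -/
/-- The product `∏_{k=1}^{n-1} k^(2^(n-k-1))` satisfies `P (n+1) = P n ^ 2 * n`. -/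
theorem prod_pow_two_pow_succ (n : ℕ) (hn : 1 ≤ n) :
    ∏ k ∈ Finset.Icc 1 n, (k : ℚ) ^ 2 ^ (n + 1 - k - 1) =
      (∏ k ∈ Finset.Icc 1 (n - 1), (k : ℚ) ^ 2 ^ (n - k - 1)) ^ 2 * n := by
  obtain ⟨m, rfl⟩ := Nat.exists_eq_add_of_le' hn
  rw [Finset.prod_Icc_succ_top (by omega), ← Finset.prod_pow]
  congr 1
  · refine Finset.prod_congr rfl fun k hk => ?_
    have hk := (Finset.mem_Icc.mp hk).2
    rw [← pow_mul, ← pow_succ]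
    congr 2
    omega
  · simp

/-- The recursion coefficient of `r` exceeds `n - 1`. -/
theorem mul_sq_le_r (n : ℕ) : ((n : ℚ) + 2) * r (n + 3) ^ 2 ≤ r (n + 4) := by
  rw [r]
  gcongr
  rw [le_div_iff₀ (by positivity)]
  nlinarith [(Nat.cast_nonneg n : (0 : ℚ) ≤ n)]

/-- for every `n ≥ 1`, `r(n+1) > ∏_{k=1}^{n-1} k^(2^(n-k-1))`
(the empty product for `n = 1` being `1`). -/
theorem r_gt_prod (n : ℕ) (hn : 1 ≤ n) :
    r (n + 1) > ∏ k ∈ Finset.Icc 1 (n - 1), (k : ℚ) ^ 2 ^ (n - k - 1) := by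
  induction n, hn using Nat.le_induction with
  | base => norm_num [r]
  | succ n hn ih =>
    rw [Nat.add_sub_cancel, prod_pow_two_pow_succ n hn]
    obtain rfl | hn2 := hn.eq_or_lt
    · norm_num [r]
    · obtain ⟨m, rfl⟩ := Nat.exists_eq_add_of_le' hn2
      refine lt_of_lt_of_le ?_ (mul_sq_le_r m)
      rw [mul_comm]
      push_cast
      gcongr
      exact ih
end
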